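/- arXiv:1709.04750 — 11 statements merged into one kernel-verified Lean document; each statement's English description precedes it below -/
import Mathlib

section
/- A finite simple graph G is edge-transitive if and only if for every pair of edges e₁ and e₂ of G, the graph G − e₁ (obtained from G by deleting the edge e₁) is isomorphic to the graph G − e₂ (obtained from G by deleting the edge e₂). -/
/-- A graph is edge-transitive if its automorphism group acts transitively on its edge set. -/
def EdgeTransitive {V : Type*} (G : SimpleGraph V) : Prop :=
  ∀ e₁ ∈ G.edgeSet, ∀ e₂ ∈ G.edgeSet, ∃ φ : G ≃g G, Sym2.map φ e₁ = e₂

namespace SimpleGraph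

/-- Two vertices with the same neighbours outside themselves are exchanged by an automorphism. -/
lemma exists_iso_swap_of_twins {V : Type*} (H : SimpleGraph V) {x y : V}
    (h : ∀ w, w ≠ x → w ≠ y → (H.Adj x w ↔ H.Adj y w)) :
    ∃ σ : H ≃g H, σ x = y ∧ ∀ z, z ≠ x → z ≠ y → σ z = z := by
  classical
  refine ⟨⟨Equiv.swap x y, ?_⟩, Equiv.swap_apply_left x y,
    fun z => Equiv.swap_apply_of_ne_of_ne⟩
  intro s t
  have hs := H.adj_comm
  simp only [Equiv.swap_apply_def]
  split_ifs <;> grind [SimpleGraph.irrefl]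

lemma exists_iso_map_eq_of_deleteEdges_iso {V : Type*} {G : SimpleGraph V} {u₁ v₁ u₂ v₂ : V}
    (h₁ : G.Adj u₁ v₁) (h₂ : G.Adj u₂ v₂)
    (φ : G.deleteEdges {s(u₁, v₁)} ≃g G.deleteEdges {s(u₂, v₂)})
    (hu : φ u₁ = u₂) (hv : φ v₁ = v₂) :
    ∃ ψ : G ≃g G, Sym2.map ψ s(u₁, v₁) = s(u₂, v₂) := by
  refine ⟨⟨φ.toEquiv, ?_⟩, ?_⟩
  · intro s t
    have h := φ.map_rel_iff (a := s) (b := t)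
    change G.Adj (φ s) (φ t) ↔ G.Adj s t
    have e : s(φ s, φ t) = s(u₂, v₂) ↔ s(s, t) = s(u₁, v₁) := by
      simp [← hu, ← hv]
    simp only [deleteEdges_adj, Set.mem_singleton_iff, e] at h
    by_cases hst : s(s, t) = s(u₁, v₁)
    · have a₁ : G.Adj s t := by rw [← mem_edgeSet, hst]; exact h₁
      have a₂ : G.Adj (φ s) (φ t) := by rw [← mem_edgeSet, e.2 hst]; exact h₂
      exact iff_of_true a₂ a₁
    · simpa [hst] using h
  · change s(φ u₁, φ v₁) = _
    rw [hu, hv]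

lemma not_adj_of_degree_eq_zero {V : Type*} {H : SimpleGraph V} {x : V}
    [Fintype (H.neighborSet x)] (hx : H.degree x = 0) (w : V) : ¬ H.Adj x w :=
  fun h => ((H.degree_pos_iff_exists_adj x).2 ⟨w, h⟩).ne' hx

section Degree

open scoped Classical

variable {V : Type*} [Fintype V] {G : SimpleGraph V}

lemma degree_deleteEdges_singleton_left {u v : V} (h : G.Adj u v) :
    (G.deleteEdges {s(u, v)}).degree u + 1 = G.degree u := by
  have e : (G.deleteEdges {s(u, v)}).neighborFinset u = (G.neighborFinset u).erase v := by
    ext w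
    simp only [mem_neighborFinset, deleteEdges_adj, Set.mem_singleton_iff, Finset.mem_erase]
    grind
  rw [← card_neighborFinset_eq_degree, e, Finset.card_erase_add_one (by simpa using h),
    card_neighborFinset_eq_degree]

lemma degree_deleteEdges_singleton_right {u v : V} (h : G.Adj u v) :
    (G.deleteEdges {s(u, v)}).degree v + 1 = G.degree v := by
  rw [Sym2.eq_swap]
  exact degree_deleteEdges_singleton_left h.symm

lemma degree_deleteEdges_singleton_of_ne {u v w : V} (hu : w ≠ u) (hv : w ≠ v) :
    (G.deleteEdges {s(u, v)}).degree w = G.degree w := by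
  rw [← card_neighborFinset_eq_degree, ← card_neighborFinset_eq_degree]
  congr 1
  ext x
  simp only [mem_neighborFinset, deleteEdges_adj, Set.mem_singleton_iff]
  grind

lemma sum_degree_sub_deleteEdges_singleton {u v : V} (h : G.Adj u v) (f : ℤ → ℤ) :
    ∑ w, f (G.degree w) - ∑ w, f ((G.deleteEdges {s(u, v)}).degree w) =
      (f (G.degree u) - f (G.degree u - 1)) + (f (G.degree v) - f (G.degree v - 1)) := by
  rw [← Finset.sum_sub_distrib, Fintype.sum_eq_add u v h.ne]
  · rw [← degree_deleteEdges_singleton_left h, ← degree_deleteEdges_singleton_right h]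
    push_cast
    simp
  · rintro w ⟨hu, hv⟩
    rw [degree_deleteEdges_singleton_of_ne hu hv, sub_self]

/-- Edges with isomorphic edge-deleted subgraphs have the same unordered pair of end degrees. -/
lemma degrees_eq_of_deleteEdges_iso {u₁ v₁ u₂ v₂ : V} (h₁ : G.Adj u₁ v₁) (h₂ : G.Adj u₂ v₂)
    (φ : G.deleteEdges {s(u₁, v₁)} ≃g G.deleteEdges {s(u₂, v₂)}) :
    (G.degree u₁ = G.degree u₂ ∧ G.degree v₁ = G.degree v₂) ∨
      (G.degree u₁ = G.degree v₂ ∧ G.degree v₁ = G.degree u₂) := by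
  have key (f : ℤ → ℤ) :
      (f (G.degree u₁) - f (G.degree u₁ - 1)) + (f (G.degree v₁) - f (G.degree v₁ - 1)) =
      (f (G.degree u₂) - f (G.degree u₂ - 1)) + (f (G.degree v₂) - f (G.degree v₂ - 1)) := by
    rw [← sum_degree_sub_deleteEdges_singleton h₁, ← sum_degree_sub_deleteEdges_singleton h₂,
      ← Equiv.sum_comp φ.toEquiv (fun w => f ((G.deleteEdges {s(u₂, v₂)}).degree w))]
    congr 1
    refine Finset.sum_congr rfl fun w _ => ?_
    rw [← φ.degree_eq w]
    rfl
  have k₂ := key (· ^ 2)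
  have k₃ := key (· ^ 3)
  have s : (G.degree v₁ : ℤ) = G.degree u₂ + G.degree v₂ - G.degree u₁ := by linarith
  have p : ((G.degree u₁ : ℤ) - G.degree u₂) * (G.degree u₁ - G.degree v₂) = 0 := by
    rw [s] at k₃
    linarith
  rcases mul_eq_zero.1 p with p | p
  · left; omega
  · right; omega

/-- An isomorphism of edge-deleted subgraphs matching the ends of smaller degree can be corrected
to an automorphism of the whole graph. -/
lemma exists_iso_map_eq_of_apply_eq {u₁ v₁ u₂ v₂ : V} (h₁ : G.Adj u₁ v₁) (h₂ : G.Adj u₂ v₂)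
    (hdeg : ∀ x y, G.Adj x y → (G.degree x = G.degree u₂ ∧ G.degree y = G.degree v₂) ∨
      (G.degree x = G.degree v₂ ∧ G.degree y = G.degree u₂))
    (hu : G.degree u₁ = G.degree u₂) (hv : G.degree v₁ = G.degree v₂)
    (hle : G.degree u₂ ≤ G.degree v₂)
    (φ : G.deleteEdges {s(u₁, v₁)} ≃g G.deleteEdges {s(u₂, v₂)}) (hφ : φ u₁ = u₂) :
    ∃ ψ : G ≃g G, Sym2.map ψ s(u₁, v₁) = s(u₂, v₂) := by
  by_cases hq : φ v₁ = v₂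
  · exact exists_iso_map_eq_of_deleteEdges_iso h₁ h₂ φ hφ hq
  have hqu : φ v₁ ≠ u₂ := fun h => h₁.ne (φ.injective (hφ.trans h.symm))
  have du₁ := degree_deleteEdges_singleton_left h₁
  have dv₁ := degree_deleteEdges_singleton_right h₁
  have du₂ := degree_deleteEdges_singleton_left h₂
  have dv₂ := degree_deleteEdges_singleton_right h₂
  have dq := φ.degree_eq v₁
  have dq' := degree_deleteEdges_singleton_of_ne (G := G) hqu hq
  suffices twins : ∀ w, w ≠ φ v₁ → w ≠ v₂ → ((G.deleteEdges {s(u₂, v₂)}).Adj (φ v₁) w ↔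
      (G.deleteEdges {s(u₂, v₂)}).Adj v₂ w) by
    obtain ⟨σ, hσ, hσ'⟩ := exists_iso_swap_of_twins _ twins
    refine exists_iso_map_eq_of_deleteEdges_iso h₁ h₂ (φ.trans σ) ?_ hσ
    change σ (φ u₁) = u₂
    rw [hφ]
    exact hσ' _ hqu.symm h₂.ne
  rcases Nat.eq_zero_or_pos ((G.deleteEdges {s(u₂, v₂)}).degree (φ v₁)) with h0 | hpos
  · exact fun w _ _ => iff_of_false (not_adj_of_degree_eq_zero h0 w) (not_adj_of_degree_eq_zero (by omega) w)
  have nbr : ∀ w, (G.deleteEdges {s(u₂, v₂)}).Adj (φ v₁) w → w = v₂ := by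
    intro w hw
    by_contra hwv
    obtain ⟨r, rfl⟩ := φ.surjective w
    have hr := φ.map_adj_iff.1 hw
    have hrG := (deleteEdges_adj.1 hr).1
    have hru : r ≠ u₁ := by
      rintro rfl
      exact (deleteEdges_adj.1 hr).2 (by simp [Sym2.eq_swap])
    have dr := degree_deleteEdges_singleton_of_ne (G := G) hru hrG.ne'
    have dr' := φ.degree_eq r
    have hwu : φ r ≠ u₂ := fun h => hru (φ.injective (h.trans hφ.symm))
    have dw := degree_deleteEdges_singleton_of_ne (G := G) hwu hwv
    have e₁ := hdeg _ _ hrG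
    have e₂ := hdeg _ _ (deleteEdges_adj.1 hw).1
    omega
  have hqv : (G.deleteEdges {s(u₂, v₂)}).Adj (φ v₁) v₂ := by
    obtain ⟨w, hw⟩ := (degree_pos_iff_exists_adj _ _).1 hpos
    exact nbr w hw ▸ hw
  have hone : (G.deleteEdges {s(u₂, v₂)}).degree (φ v₁) = 1 :=
    degree_eq_one_iff_existsUnique_adj.2 ⟨v₂, hqv, nbr⟩
  obtain ⟨y, -, hy⟩ := degree_eq_one_iff_existsUnique_adj.1
    (show (G.deleteEdges {s(u₂, v₂)}).degree v₂ = 1 by omega)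
  refine fun w hwq hwv => iff_of_false (fun h => hwv (nbr w h)) fun h => hwq ?_
  rw [hy w h, hy _ hqv.symm]

lemma exists_iso_map_eq_of_degree_le {u₁ v₁ u₂ v₂ : V} (h₁ : G.Adj u₁ v₁) (h₂ : G.Adj u₂ v₂)
    (hdeg : ∀ x y, G.Adj x y → (G.degree x = G.degree u₂ ∧ G.degree y = G.degree v₂) ∨
      (G.degree x = G.degree v₂ ∧ G.degree y = G.degree u₂))
    (hu : G.degree u₁ = G.degree u₂) (hv : G.degree v₁ = G.degree v₂)
    (hle : G.degree u₂ ≤ G.degree v₂)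
    (φ : G.deleteEdges {s(u₁, v₁)} ≃g G.deleteEdges {s(u₂, v₂)}) :
    ∃ ψ : G ≃g G, Sym2.map ψ s(u₁, v₁) = s(u₂, v₂) := by
  by_cases hp : φ u₁ = u₂
  · exact exists_iso_map_eq_of_apply_eq h₁ h₂ hdeg hu hv hle φ hp
  have du₁ := degree_deleteEdges_singleton_left h₁
  have du₂ := degree_deleteEdges_singleton_left h₂
  have dv₂ := degree_deleteEdges_singleton_right h₂
  have dp := φ.degree_eq u₁
  by_cases hp' : φ u₁ = v₂
  · rw [hp'] at dp
    have e : G.degree u₂ = G.degree v₂ := by omega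
    have hswap : s(u₂, v₂) = s(v₂, u₂) := Sym2.eq_swap
    clear hp du₂ dv₂ dp
    revert φ
    rw [hswap]
    intro φ hp'
    exact exists_iso_map_eq_of_apply_eq h₁ h₂.symm (fun x y h => (hdeg x y h).symm)
      (hu.trans e) (hv.trans e.symm) e.ge φ hp'
  have dp' := degree_deleteEdges_singleton_of_ne (G := G) hp hp'
  have hp0 : G.degree (φ u₁) = 0 := by
    by_contra h0
    obtain ⟨w, hw⟩ := (degree_pos_iff_exists_adj _ _).1 (Nat.pos_of_ne_zero h0)
    have := hdeg _ _ hw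
    omega
  obtain ⟨σ, hσ, -⟩ := exists_iso_swap_of_twins (G.deleteEdges {s(u₂, v₂)})
    (x := φ u₁) (y := u₂) fun w _ _ =>
      iff_of_false (not_adj_of_degree_eq_zero (by omega) w) (not_adj_of_degree_eq_zero (by omega) w)
  exact exists_iso_map_eq_of_apply_eq h₁ h₂ hdeg hu hv hle (φ.trans σ) hσ

end Degree

end SimpleGraph

/-- A finite simple graph `G` is edge-transitive if and only if `G - e₁ ≅ G - e₂`
for all pairs of edges `e₁` and `e₂` of `G`. -/
theorem edgeTransitive_iff_deleteEdges_iso {V : Type*} [Fintype V] (G : SimpleGraph V) :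
    EdgeTransitive G ↔
      ∀ e₁ ∈ G.edgeSet, ∀ e₂ ∈ G.edgeSet,
        Nonempty (G.deleteEdges {e₁} ≃g G.deleteEdges {e₂}) := by
  classical
  constructor
  · intro h e₁ he₁ e₂ he₂
    obtain ⟨φ, rfl⟩ := h e₁ he₁ e₂ he₂
    refine ⟨⟨φ.toEquiv, ?_⟩⟩
    intro s t
    have e : s(φ s, φ t) = Sym2.map φ e₁ ↔ s(s, t) = e₁ :=
      (Sym2.map.injective φ.injective).eq_iff (a := s(s, t))
    change (G.deleteEdges _).Adj (φ s) (φ t) ↔ _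
    simp only [SimpleGraph.deleteEdges_adj, Set.mem_singleton_iff, e, φ.map_adj_iff]
  · intro h
    have hdeg : ∀ u v, G.Adj u v → ∀ x y, G.Adj x y →
        (G.degree x = G.degree u ∧ G.degree y = G.degree v) ∨
          (G.degree x = G.degree v ∧ G.degree y = G.degree u) := by
      intro u v huv x y hxy
      obtain ⟨φ⟩ := h s(x, y) hxy s(u, v) huv
      convert SimpleGraph.degrees_eq_of_deleteEdges_iso hxy huv φ
    have oriented : ∀ e ∈ G.edgeSet, ∃ u v, e = s(u, v) ∧ G.Adj u v ∧ G.degree u ≤ G.degree v := by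
      intro e he
      induction e with | _ u v
      rcases le_total (G.degree u) (G.degree v) with hle | hle
      · exact ⟨u, v, rfl, he, hle⟩
      · exact ⟨v, u, Sym2.eq_swap, SimpleGraph.Adj.symm he, hle⟩
    intro e₁ he₁ e₂ he₂
    obtain ⟨φ⟩ := h e₁ he₁ e₂ he₂
    obtain ⟨u₁, v₁, rfl, h₁, hle₁⟩ := oriented e₁ he₁
    obtain ⟨u₂, v₂, rfl, h₂, hle₂⟩ := oriented e₂ he₂
    have hd := hdeg _ _ h₂ _ _ h₁
    apply SimpleGraph.exists_iso_map_eq_of_degree_le h₁ h₂ (φ := φ)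
    · intro x y hxy
      convert hdeg _ _ h₂ _ _ hxy
    · convert (show G.degree u₁ = G.degree u₂ by omega)
    · convert (show G.degree v₁ = G.degree v₂ by omega)
    · convert hle₂
end

section
/- A connected finite simple graph G is edge-transitive if and only if its line graph L(G) is vertex-transitive. -/
/-- A graph is vertex-transitive if its automorphism group acts transitively on its vertex set. -/
def VertexTransitive {V : Type*} (G : SimpleGraph V) : Prop :=
  ∀ u v, ∃ φ : G ≃g G, φ u = v

namespace SimpleGraph

variable {V : Type*} {G : SimpleGraph V}

/-- In a connected graph, a nonempty set of vertices closed under adjacency is everything. -/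
theorem Connected.forall_of_adj_closed (hconn : G.Connected) {p : V → Prop} {x : V} (hx : p x)
    (h : ∀ y z, p y → G.Adj y z → p z) (y : V) : p y := by
  obtain ⟨w⟩ := hconn.preconnected x y
  induction w with
  | nil => exact hx
  | cons hadj _ ih => exact ih (h _ _ hx hadj)

/-- Distinct edges have at most one common endpoint. -/
theorem eq_of_mem_of_mem_edges {e f : G.edgeSet} (hne : e ≠ f) {x y : V}
    (hxe : x ∈ (e : Sym2 V)) (hxf : x ∈ (f : Sym2 V))
    (hye : y ∈ (e : Sym2 V)) (hyf : y ∈ (f : Sym2 V)) : x = y := by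
  by_contra hxy
  exact hne (Subtype.ext (((Sym2.mem_and_mem_iff hxy).1 ⟨hxe, hye⟩).trans
    ((Sym2.mem_and_mem_iff hxy).1 ⟨hxf, hyf⟩).symm))

/-- The graph has exactly four vertices, one of which is adjacent to all the others. -/
def HasSpanningClaw (G : SimpleGraph V) : Prop :=
  ∃ x a b c : V, G.Adj x a ∧ G.Adj x b ∧ G.Adj x c ∧ a ≠ b ∧ a ≠ c ∧ b ≠ c ∧
    ∀ y, y = x ∨ y = a ∨ y = b ∨ y = c

/-- If three pairwise intersecting edges have no common endpoint, they form a triangle, and any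
other edge meets an even number of them. -/
theorem lineGraph_adj_triangle {e f g h : G.edgeSet}
    (hef : G.lineGraph.Adj e f) (heg : G.lineGraph.Adj e g) (hfg : G.lineGraph.Adj f g)
    (hno : ¬ ∃ x, x ∈ (e : Sym2 V) ∧ x ∈ (f : Sym2 V) ∧ x ∈ (g : Sym2 V))
    (he : h ≠ e) (hf : h ≠ f) (hg : h ≠ g) :
    ¬ (G.lineGraph.Adj h e ∧ G.lineGraph.Adj h f ∧ G.lineGraph.Adj h g) ∧
    (G.lineGraph.Adj h e → G.lineGraph.Adj h f ∨ G.lineGraph.Adj h g) := by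
  rw [lineGraph_adj_iff_exists] at hef heg hfg
  obtain ⟨-, p, hpe, hpf⟩ := hef
  obtain ⟨-, q, hqe, hqg⟩ := heg
  obtain ⟨-, r, hrf, hrg⟩ := hfg
  have hpq : p ≠ q := by rintro rfl; exact hno ⟨p, hpe, hpf, hqg⟩
  have hpr : p ≠ r := by rintro rfl; exact hno ⟨p, hpe, hpf, hrg⟩
  have hqr : q ≠ r := by rintro rfl; exact hno ⟨q, hqe, hrf, hqg⟩
  have e1 := (Sym2.mem_and_mem_iff hpq).1 ⟨hpe, hqe⟩
  have f1 := (Sym2.mem_and_mem_iff hpr).1 ⟨hpf, hrf⟩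
  have g1 := (Sym2.mem_and_mem_iff hqr).1 ⟨hqg, hrg⟩
  simp only [lineGraph_adj_iff_exists, ne_eq, he, hf, hg, not_false_eq_true, true_and]
  replace he : (h : Sym2 V) ≠ e := fun hh => he (Subtype.ext hh)
  replace hf : (h : Sym2 V) ≠ f := fun hh => hf (Subtype.ext hh)
  replace hg : (h : Sym2 V) ≠ g := fun hh => hg (Subtype.ext hh)
  rw [e1] at he ⊢
  rw [f1] at hf ⊢
  rw [g1] at hg ⊢
  generalize (h : Sym2 V) = k at *
  induction k with
  | _ s t =>
    simp only [Sym2.mem_iff, ne_eq, Sym2.eq_iff] at *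
    constructor
    · rintro ⟨⟨x, hx, hx'⟩, ⟨y, hy, hy'⟩, ⟨z, hz, hz'⟩⟩
      grind
    · rintro ⟨x, hx, rfl | rfl⟩
      · exact Or.inl ⟨x, hx, Or.inl rfl⟩
      · exact Or.inr ⟨x, hx, Or.inl rfl⟩

/-- Unless `G` has a spanning claw on four vertices, automorphisms of the line graph preserve
triples of edges with a common endpoint. -/
theorem exists_common_mem_map (hconn : G.Connected) (hclaw : ¬ G.HasSpanningClaw)
    (φ : G.lineGraph ≃g G.lineGraph) {e f g : G.edgeSet} (hef : e ≠ f) (heg : e ≠ g) (hfg : f ≠ g)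
    {x : V} (hxe : x ∈ (e : Sym2 V)) (hxf : x ∈ (f : Sym2 V)) (hxg : x ∈ (g : Sym2 V)) :
    ∃ y, y ∈ (φ e : Sym2 V) ∧ y ∈ (φ f : Sym2 V) ∧ y ∈ (φ g : Sym2 V) := by
  by_contra hno
  have aef : G.lineGraph.Adj e f := lineGraph_adj_iff_exists.2 ⟨hef, x, hxe, hxf⟩
  have aeg : G.lineGraph.Adj e g := lineGraph_adj_iff_exists.2 ⟨heg, x, hxe, hxg⟩
  have afg : G.lineGraph.Adj f g := lineGraph_adj_iff_exists.2 ⟨hfg, x, hxf, hxg⟩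
  have key : ∀ h, h ≠ e → h ≠ f → h ≠ g →
      ¬ (G.lineGraph.Adj h e ∧ G.lineGraph.Adj h f ∧ G.lineGraph.Adj h g) ∧
      (G.lineGraph.Adj h e → G.lineGraph.Adj h f ∨ G.lineGraph.Adj h g) ∧
      (G.lineGraph.Adj h f → G.lineGraph.Adj h e ∨ G.lineGraph.Adj h g) ∧
      (G.lineGraph.Adj h g → G.lineGraph.Adj h e ∨ G.lineGraph.Adj h f) := by
    intro h he hf hg
    have he' := φ.injective.ne he
    have hf' := φ.injective.ne hf
    have hg' := φ.injective.ne hg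
    have ef := φ.map_adj_iff.2 aef
    have eg := φ.map_adj_iff.2 aeg
    have fg := φ.map_adj_iff.2 afg
    have h1 := lineGraph_adj_triangle ef eg fg hno he' hf' hg'
    have h2 := lineGraph_adj_triangle ef.symm fg eg
      (fun ⟨y, h1, h2, h3⟩ => hno ⟨y, h2, h1, h3⟩) hf' he' hg'
    have h3 := lineGraph_adj_triangle eg.symm fg.symm ef
      (fun ⟨y, h1, h2, h3⟩ => hno ⟨y, h2, h3, h1⟩) hg' he' hf'
    simp only [φ.map_adj_iff] at h1 h2 h3
    exact ⟨h1.1, h1.2, h2.2, h3.2⟩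
  obtain ⟨a, ha⟩ := Sym2.mem_iff_exists.1 hxe
  obtain ⟨b, hb⟩ := Sym2.mem_iff_exists.1 hxf
  obtain ⟨c, hc⟩ := Sym2.mem_iff_exists.1 hxg
  obtain ⟨e, he⟩ := e
  obtain ⟨f, hf⟩ := f
  obtain ⟨g, hg⟩ := g
  subst ha hb hc
  rw [mem_edgeSet] at he hf hg
  have hab : a ≠ b := by rintro rfl; exact hef rfl
  have hac : a ≠ c := by rintro rfl; exact heg rfl
  have hbc : b ≠ c := by rintro rfl; exact hfg rfl
  refine hclaw ⟨x, a, b, c, he, hf, hg, hab, hac, hbc,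
    hconn.forall_of_adj_closed (x := x) (Or.inl rfl) ?_⟩
  intro y z hy hyz
  by_contra! hz
  have hk := key ⟨s(y, z), hyz⟩
  simp only [lineGraph_adj_iff_exists, ne_eq, Sym2.mem_iff] at hk
  obtain ⟨hzx, hza, hzb, hzc⟩ := hz
  have := he.ne
  have := hf.ne
  have := hg.ne
  specialize hk (by grind) (by grind) (by grind)
  rcases hy with rfl | rfl | rfl | rfl
  · exact hk.1 ⟨⟨by grind, y, by grind⟩, ⟨by grind, y, by grind⟩, ⟨by grind, y, by grind⟩⟩
  · have := hk.2.1 ⟨by grind, y, by grind⟩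
    grind
  · have := hk.2.2.1 ⟨by grind, y, by grind⟩
    grind
  · have := hk.2.2.2 ⟨by grind, y, by grind⟩
    grind

/-- The vertex `w` corresponds to `v` under `φ`: the edges at `v` are mapped to those at `w`. -/
def StarMap (φ : G.lineGraph ≃g G.lineGraph) (v w : V) : Prop :=
  ∀ e : G.edgeSet, v ∈ (e : Sym2 V) ↔ w ∈ (φ e : Sym2 V)

theorem StarMap.symm {φ : G.lineGraph ≃g G.lineGraph} {v w : V} (h : StarMap φ v w) :
    StarMap φ.symm w v := fun e => by simpa using (h (φ.symm e)).symm

theorem Connected.exists_edge_mem [Nontrivial V] (hconn : G.Connected) (v : V) :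
    ∃ e : G.edgeSet, v ∈ (e : Sym2 V) := by
  obtain ⟨w, hw⟩ := hconn.preconnected.exists_adj_of_nontrivial v
  exact ⟨⟨s(v, w), hw⟩, by simp⟩

/-- In a connected graph with at least two edges, any edge has another edge at one of its
endpoints. -/
theorem Connected.exists_ne_edge_mem (hconn : G.Connected) [Nontrivial G.edgeSet] {u v : V}
    (huv : G.Adj u v) :
    ∃ e : G.edgeSet, (e : Sym2 V) ≠ s(u, v) ∧ (u ∈ (e : Sym2 V) ∨ v ∈ (e : Sym2 V)) := by
  by_contra! h
  have hall := hconn.forall_of_adj_closed (p := fun y => y = u ∨ y = v) (x := u) (Or.inl rfl) (by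
    intro y z hy hyz
    have := h ⟨s(y, z), hyz⟩
    simp only [ne_eq, Sym2.mem_iff, Sym2.eq_iff] at this
    grind)
  obtain ⟨e, he⟩ := exists_ne (⟨s(u, v), huv⟩ : G.edgeSet)
  refine (h e fun hh => he (Subtype.ext hh)).elim ?_
  obtain ⟨⟨p, q⟩, hpq⟩ := e
  rcases hall p with rfl | rfl
  · exact fun hp _ => hp (Sym2.mem_mk_left _ _)
  · rcases hall q with rfl | rfl
    · exact fun hq _ => hq (Sym2.mem_mk_right _ _)
    · exact (G.loopless.irrefl _ hpq).elim

theorem Connected.eq_of_same_edges (hconn : G.Connected) [Nontrivial G.edgeSet] [Nontrivial V]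
    {v w : V} (h : ∀ e : G.edgeSet, v ∈ (e : Sym2 V) ↔ w ∈ (e : Sym2 V)) : v = w := by
  by_contra hvw
  obtain ⟨⟨e, he⟩, hve⟩ := hconn.exists_edge_mem v
  obtain rfl := (Sym2.mem_and_mem_iff hvw).1 ⟨hve, (h ⟨e, he⟩).1 hve⟩
  obtain ⟨f, hf, hmem⟩ := hconn.exists_ne_edge_mem he
  refine hf ((Sym2.mem_and_mem_iff hvw).1 ?_)
  have := h f
  tauto

theorem exists_starMap_of_two_edges (hconn : G.Connected) (hclaw : ¬ G.HasSpanningClaw)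
    (φ : G.lineGraph ≃g G.lineGraph) {v : V} {e f : G.edgeSet} (hef : e ≠ f)
    (he : v ∈ (e : Sym2 V)) (hf : v ∈ (f : Sym2 V)) : ∃ w, StarMap φ v w := by
  have hadj := φ.map_adj_iff.2 (lineGraph_adj_iff_exists.2 ⟨hef, v, he, hf⟩)
  obtain ⟨hne, w, hwe, hwf⟩ := lineGraph_adj_iff_exists.1 hadj
  refine ⟨w, fun g => ?_⟩
  by_cases heg : e = g
  · subst heg; simp [he, hwe]
  by_cases hfg : f = g
  · subst hfg; simp [hf, hwf]
  constructor
  · intro hg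
    obtain ⟨y, h1, h2, h3⟩ := exists_common_mem_map hconn hclaw φ hef heg hfg he hf hg
    rwa [eq_of_mem_of_mem_edges hne hwe hwf h1 h2]
  · intro hg
    obtain ⟨y, h1, h2, h3⟩ := exists_common_mem_map hconn hclaw φ.symm hne
      (φ.injective.ne heg) (φ.injective.ne hfg) hwe hwf hg
    simp only [RelIso.symm_apply_apply] at h1 h2 h3
    rwa [eq_of_mem_of_mem_edges hef he hf h1 h2]

theorem exists_starMap (hconn : G.Connected) [Nontrivial G.edgeSet] [Nontrivial V]
    (hclaw : ¬ G.HasSpanningClaw) (φ : G.lineGraph ≃g G.lineGraph) (v : V) :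
    ∃ w, StarMap φ v w := by
  obtain ⟨e, he⟩ := hconn.exists_edge_mem v
  by_cases hdeg : ∃ f, e ≠ f ∧ v ∈ (f : Sym2 V)
  · obtain ⟨f, hef, hf⟩ := hdeg
    exact exists_starMap_of_two_edges hconn hclaw φ hef he hf
  push Not at hdeg
  obtain ⟨u, hu⟩ := Sym2.mem_iff_exists.1 he
  have hvu : G.Adj v u := by rw [← mem_edgeSet, ← hu]; exact e.2
  obtain ⟨f, hf, hmem⟩ := hconn.exists_ne_edge_mem hvu
  have hef : e ≠ f := by rintro rfl; exact hf hu
  have huf : u ∈ (f : Sym2 V) := hmem.resolve_left (hdeg f hef)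
  have hue : u ∈ (e : Sym2 V) := by simp [hu]
  obtain ⟨w, hw⟩ := exists_starMap_of_two_edges hconn hclaw φ hef hue huf
  obtain ⟨w', hw'⟩ := Sym2.mem_iff_exists.1 ((hw e).1 hue)
  have hww' : G.Adj w w' := by rw [← mem_edgeSet, ← hw']; exact (φ e).2
  have hwe' : w' ∈ (φ e : Sym2 V) := by simp [hw']
  refine ⟨w', fun g => ?_⟩
  by_cases heg : e = g
  · subst heg; simp [he, hwe']
  refine iff_of_false (hdeg g heg) fun hg => ?_
  obtain ⟨x, hx⟩ := exists_starMap_of_two_edges hconn hclaw φ.symm (φ.injective.ne heg) hwe' hg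
  replace hx : StarMap φ x w' := hx.symm
  have hxe := (hx e).2 hwe'
  rw [hu, Sym2.mem_iff] at hxe
  rcases hxe with rfl | rfl
  · exact hdeg g heg ((hx g).2 hg)
  · refine hww'.ne (hconn.eq_of_same_edges fun k => ?_)
    simpa using (hw (φ.symm k)).symm.trans (hx (φ.symm k))

/-- **Whitney's theorem** for automorphisms: unless `G` has a spanning claw on four vertices, every
automorphism of the line graph of a connected graph with at least two edges is induced by an
automorphism of the graph. -/
theorem exists_iso_of_lineGraph_iso (hconn : G.Connected) [Nontrivial G.edgeSet]
    (hclaw : ¬ G.HasSpanningClaw) (φ : G.lineGraph ≃g G.lineGraph) :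
    ∃ ψ : G ≃g G, ∀ e : G.edgeSet, Sym2.map ψ e = φ e := by
  have : Nontrivial V := by
    obtain ⟨⟨⟨p, q⟩, hpq⟩⟩ := (inferInstance : Nonempty G.edgeSet)
    exact ⟨p, q, G.ne_of_adj hpq⟩
  choose ψ hψ using exists_starMap hconn hclaw φ
  choose θ hθ using exists_starMap hconn hclaw φ.symm
  have hl : ∀ v, θ (ψ v) = v := fun v => hconn.eq_of_same_edges fun e => by
    have h1 := hψ v e
    have h2 := hθ (ψ v) (φ e)
    simp only [RelIso.symm_apply_apply] at h2
    exact (h1.trans h2).symm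
  have hr : ∀ v, ψ (θ v) = v := fun v => hconn.eq_of_same_edges fun e => by
    have h1 := hθ v e
    have h2 := hψ (θ v) (φ.symm e)
    simp only [RelIso.apply_symm_apply] at h2
    exact (h1.trans h2).symm
  have hψe : ∀ {u v} (h : G.Adj u v), (φ ⟨s(u, v), h⟩ : Sym2 V) = s(ψ u, ψ v) := fun {u v} h =>
    (Sym2.mem_and_mem_iff ((Function.LeftInverse.injective hl).ne h.ne)).1
      ⟨(hψ u _).1 (by simp), (hψ v _).1 (by simp)⟩
  have hθe : ∀ {u v} (h : G.Adj u v), (φ.symm ⟨s(u, v), h⟩ : Sym2 V) = s(θ u, θ v) :=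
    fun {u v} h => (Sym2.mem_and_mem_iff ((Function.LeftInverse.injective hr).ne h.ne)).1
      ⟨(hθ u _).1 (by simp), (hθ v _).1 (by simp)⟩
  refine ⟨⟨⟨ψ, θ, hl, hr⟩, ?_⟩, ?_⟩
  · intro u v
    constructor
    · intro h
      have h' := (φ.symm ⟨s(ψ u, ψ v), h⟩).2
      rwa [hθe (u := ψ u) (v := ψ v) h, hl, hl] at h'
    · intro h
      have h' := (φ ⟨s(u, v), h⟩).2
      rwa [hψe h] at h'
  · rintro ⟨⟨u, v⟩, h⟩
    exact (hψe h).symm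

theorem edgeTransitive_top : EdgeTransitive (⊤ : SimpleGraph V) := by
  classical
  rintro ⟨p, q⟩ hpq ⟨r, s⟩ hrs
  replace hpq : p ≠ q := hpq
  replace hrs : r ≠ s := hrs
  refine ⟨Iso.completeGraph ((Equiv.swap p r).trans (Equiv.swap (Equiv.swap p r q) s)), ?_⟩
  have hq : Equiv.swap p r q ≠ r := fun h =>
    hpq ((Equiv.swap p r).injective (h.trans (Equiv.swap_apply_left p r).symm)).symm
  have h1 : Equiv.swap (Equiv.swap p r q) s (Equiv.swap p r p) = r := by
    rw [Equiv.swap_apply_left, Equiv.swap_apply_of_ne_of_ne hq.symm hrs]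
  have h2 : Equiv.swap (Equiv.swap p r q) s (Equiv.swap p r q) = s := Equiv.swap_apply_left _ _
  exact congrArg₂ (fun a b => s(a, b)) h1 h2

/-- A star, that is, a graph whose edges are exactly the pairs containing `x`, is
edge-transitive. -/
theorem edgeTransitive_of_star {x : V} (h : ∀ u v, G.Adj u v ↔ u ≠ v ∧ (u = x ∨ v = x)) :
    EdgeTransitive G := by
  classical
  have key : ∀ e ∈ G.edgeSet, ∃ y, y ≠ x ∧ e = s(x, y) := by
    rintro ⟨p, q⟩ hpq
    obtain ⟨hne, rfl | rfl⟩ := (h p q).1 hpq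
    · exact ⟨q, hne.symm, rfl⟩
    · exact ⟨p, hne, Sym2.eq_swap⟩
  intro e₁ h₁ e₂ h₂
  obtain ⟨p, hp, rfl⟩ := key e₁ h₁
  obtain ⟨q, hq, rfl⟩ := key e₂ h₂
  have hx : Equiv.swap p q x = x := Equiv.swap_apply_of_ne_of_ne hp.symm hq.symm
  have hiff : ∀ u, Equiv.swap p q u = x ↔ u = x := fun u => by
    conv_lhs => rw [← hx]
    exact (Equiv.swap p q).injective.eq_iff
  refine ⟨⟨Equiv.swap p q, fun {u v} => ?_⟩, ?_⟩
  · simp [h, hiff]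
  · exact congrArg₂ (fun a b => s(a, b)) hx (Equiv.swap_apply_left p q)

/-- If the line graph is vertex-transitive and some edge meets all the others, then any two edges
meet. -/
theorem exists_mem_of_universal_edge (ht : VertexTransitive G.lineGraph) {e : G.edgeSet}
    (he : ∀ f, e ≠ f → G.lineGraph.Adj e f) {f g : G.edgeSet} (hfg : f ≠ g) :
    ∃ v, v ∈ (f : Sym2 V) ∧ v ∈ (g : Sym2 V) := by
  obtain ⟨φ, hφ⟩ := ht f e
  have h := he (φ g) (by rw [← hφ]; exact φ.injective.ne hfg)
  rw [← hφ, φ.map_adj_iff, lineGraph_adj_iff_exists] at h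
  exact h.2

theorem not_adj_of_spanningClaw (ht : VertexTransitive G.lineGraph) {x a b c : V}
    (ha : G.Adj x a) (hb : G.Adj x b) (hc : G.Adj x c) (hab : a ≠ b) (hac : a ≠ c) (hbc : b ≠ c)
    (hall : ∀ y, y = x ∨ y = a ∨ y = b ∨ y = c) (hno : ¬ G.Adj a b) :
    ¬ G.Adj a c ∧ ¬ G.Adj b c := by
  have := ha.ne
  have := hb.ne
  have := hc.ne
  have huniv : ∀ f, (⟨s(x, c), hc⟩ : G.edgeSet) ≠ f → G.lineGraph.Adj ⟨s(x, c), hc⟩ f := by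
    rintro ⟨⟨p, q⟩, hpq⟩ hne
    refine lineGraph_adj_iff_exists.2 ⟨hne, ?_⟩
    change G.Adj p q at hpq
    change ∃ v, v ∈ s(x, c) ∧ v ∈ s(p, q)
    simp only [Sym2.mem_iff]
    have hba : ¬ G.Adj b a := fun h => hno h.symm
    have := hpq.ne
    by_contra! hcon
    have h1 := hcon x (Or.inl rfl)
    have h2 := hcon c (Or.inr rfl)
    have hp := hall p
    have hq := hall q
    grind
  constructor
  · intro h
    obtain ⟨v, h1, h2⟩ := exists_mem_of_universal_edge ht huniv
      (f := ⟨s(x, b), hb⟩) (g := ⟨s(a, c), h⟩)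
      (by grind)
    simp only [Sym2.mem_iff] at h1 h2
    grind
  · intro h
    obtain ⟨v, h1, h2⟩ := exists_mem_of_universal_edge ht huniv
      (f := ⟨s(x, a), ha⟩) (g := ⟨s(b, c), h⟩)
      (by grind)
    simp only [Sym2.mem_iff] at h1 h2
    grind

theorem HasSpanningClaw.edgeTransitive (hclaw : G.HasSpanningClaw)
    (ht : VertexTransitive G.lineGraph) : EdgeTransitive G := by
  obtain ⟨x, a, b, c, ha, hb, hc, hab, hac, hbc, hall⟩ := hclaw
  have h1 := not_adj_of_spanningClaw ht ha hb hc hab hac hbc hall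
  have h2 := not_adj_of_spanningClaw ht ha hc hb hac hab hbc.symm
    fun y => by have := hall y; tauto
  have h3 := not_adj_of_spanningClaw ht hb hc ha hbc hab.symm hac.symm
    fun y => by have := hall y; tauto
  rw [G.adj_comm c b] at h2
  rw [G.adj_comm b a, G.adj_comm c a] at h3
  by_cases h : G.Adj a b
  · have htop : G = ⊤ := by
      ext u v
      rw [top_adj]
      refine ⟨fun h => h.ne, fun huv => ?_⟩
      have hu := hall u
      have hv := hall v
      have hac' : G.Adj a c := by tauto
      have hbc' : G.Adj b c := by tauto
      have := h.symm
      have := hac'.symm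
      have := hbc'.symm
      have := ha.symm
      have := hb.symm
      have := hc.symm
      grind
    rw [htop]
    exact edgeTransitive_top
  · obtain ⟨hac', hbc'⟩ := h1 h
    refine edgeTransitive_of_star (x := x) fun u v => ?_
    have hu := hall u
    have hv := hall v
    have := ha.symm
    have := hb.symm
    have := hc.symm
    have hba : ¬ G.Adj b a := fun h' => h h'.symm
    have hca : ¬ G.Adj c a := fun h' => hac' h'.symm
    have hcb : ¬ G.Adj c b := fun h' => hbc' h'.symm
    have hirr : ∀ y, ¬ G.Adj y y := fun y => G.loopless.irrefl y
    grind

end SimpleGraph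

/-- A connected finite simple graph is edge-transitive if and only if its line graph is
vertex-transitive. -/
theorem edgeTransitive_iff_lineGraph_vertexTransitive {V : Type*} [Fintype V]
    (G : SimpleGraph V) (hconn : G.Connected) :
    EdgeTransitive G ↔ VertexTransitive G.lineGraph := by
  constructor
  · intro h e f
    obtain ⟨ψ, hψ⟩ := h e e.2 f f.2
    exact ⟨ψ.lineGraph, Subtype.ext hψ⟩
  · intro ht
    by_cases hclaw : G.HasSpanningClaw
    · exact hclaw.edgeTransitive ht
    intro e₁ h₁ e₂ h₂
    by_cases hne : e₁ = e₂
    · exact ⟨SimpleGraph.Iso.refl, by subst hne; exact congrFun Sym2.map_id e₁⟩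
    have : Nontrivial G.edgeSet := ⟨⟨e₁, h₁⟩, ⟨e₂, h₂⟩, fun h => hne (congrArg Subtype.val h)⟩
    obtain ⟨φ, hφ⟩ := ht ⟨e₁, h₁⟩ ⟨e₂, h₂⟩
    obtain ⟨ψ, hψ⟩ := SimpleGraph.exists_iso_of_lineGraph_iso hconn hclaw φ
    exact ⟨ψ, by rw [hψ ⟨e₁, h₁⟩, hφ]⟩
end

section
/- Let m and n be positive integers with gcd(m,n) > 2. Then there exist positive integers r and s and a connected edge-transitive (r,s) biregular subgraph of K_{m,n} that is not isomorphic to the complete bipartite graph K_{m,n} (i.e., with r < n). -/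
/-- `G` is an `(r,s)` biregular subgraph of the complete bipartite graph `K_{m,n}`:
a bipartite graph on parts `Fin m` and `Fin n` in which every edge joins the two parts,
every vertex of the left part has degree `r`, and every vertex of the right part has
degree `s`. -/
def IsBiregularSubgraph (m n r s : ℕ) (G : SimpleGraph (Fin m ⊕ Fin n)) : Prop :=
  (∀ a b : Fin m, ¬ G.Adj (Sum.inl a) (Sum.inl b)) ∧
  (∀ a b : Fin n, ¬ G.Adj (Sum.inr a) (Sum.inr b)) ∧
  (∀ a : Fin m, (G.neighborSet (Sum.inl a)).ncard = r) ∧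
  (∀ b : Fin n, (G.neighborSet (Sum.inr b)).ncard = s)

/-- The bipartite graph on `α ⊕ β` joining `a` to `b` when their colours `f a` and `g b` differ. -/
def distinctColorGraph {α β γ : Type*} (f : α → γ) (g : β → γ) : SimpleGraph (α ⊕ β) where
  Adj x y := match x, y with
    | .inl a, .inr b => f a ≠ g b
    | .inr b, .inl a => f a ≠ g b
    | _, _ => False
  symm := ⟨by rintro (a | b) (a' | b') h <;> exact h⟩
  loopless := ⟨by rintro (a | b) h <;> exact h⟩

namespace distinctColorGraph

variable {α β γ : Type*} {f : α → γ} {g : β → γ}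

@[simp] lemma adj_inl_inr {a : α} {b : β} :
    (distinctColorGraph f g).Adj (.inl a) (.inr b) ↔ f a ≠ g b := Iff.rfl

@[simp] lemma adj_inr_inl {a : α} {b : β} :
    (distinctColorGraph f g).Adj (.inr b) (.inl a) ↔ f a ≠ g b := Iff.rfl

@[simp] lemma not_adj_inl_inl {a a' : α} :
    ¬ (distinctColorGraph f g).Adj (.inl a) (.inl a') := id

@[simp] lemma not_adj_inr_inr {b b' : β} :
    ¬ (distinctColorGraph f g).Adj (.inr b) (.inr b') := id

lemma neighborSet_inl (a : α) :
    (distinctColorGraph f g).neighborSet (.inl a) = Sum.inr '' {b | g b ≠ f a} := by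
  ext (a' | b) <;> simp [eq_comm]

lemma neighborSet_inr (b : β) :
    (distinctColorGraph f g).neighborSet (.inr b) = Sum.inl '' {a | f a ≠ g b} := by
  ext (a | b') <;> simp

/-- Permutations of both sides that act compatibly on the colours give an automorphism. -/
def autOfPerm (σ : Equiv.Perm γ) (u : Equiv.Perm α) (v : Equiv.Perm β)
    (hu : ∀ a, f (u a) = σ (f a)) (hv : ∀ b, g (v b) = σ (g b)) :
    distinctColorGraph f g ≃g distinctColorGraph f g where
  toEquiv := Equiv.sumCongr u v
  map_rel_iff' := by rintro (a | b) (a' | b') <;> simp [hu, hv]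

lemma exists_of_mem_edgeSet {e : Sym2 (α ⊕ β)} (he : e ∈ (distinctColorGraph f g).edgeSet) :
    ∃ a b, f a ≠ g b ∧ e = s(.inl a, .inr b) := by
  induction e using Sym2.ind with
  | _ x y =>
    rcases x with a | b <;> rcases y with a' | b' <;> simp at he
    · exact ⟨a, b', he, rfl⟩
    · exact ⟨a', b, he, Sym2.eq_swap⟩

lemma exists_ne_of_two_lt_card [Fintype γ] (h : 2 < Fintype.card γ) (i j : γ) :
    ∃ k, k ≠ i ∧ k ≠ j := by
  classical
  obtain ⟨k, hk⟩ := Finset.exists_mem_notMem_of_card_lt_card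
    (s := {i, j}) (t := Finset.univ) (Finset.card_le_two.trans_lt h)
  exact ⟨k, by simpa using hk⟩

lemma connected [Fintype γ] (h : 2 < Fintype.card γ) (hf : f.Surjective) (hg : g.Surjective) :
    (distinctColorGraph f g).Connected := by
  have hll (a a' : α) : (distinctColorGraph f g).Reachable (.inl a) (.inl a') := by
    obtain ⟨k, hk, hk'⟩ := exists_ne_of_two_lt_card h (f a) (f a')
    obtain ⟨b, rfl⟩ := hg k
    exact (SimpleGraph.Adj.reachable (adj_inl_inr.2 hk.symm)).trans
      (SimpleGraph.Adj.reachable (adj_inr_inl.2 hk'.symm))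
  have hrl (b : β) (a : α) : (distinctColorGraph f g).Reachable (.inr b) (.inl a) := by
    obtain ⟨k, hk, -⟩ := exists_ne_of_two_lt_card h (g b) (g b)
    obtain ⟨a', rfl⟩ := hf k
    exact (SimpleGraph.Adj.reachable (adj_inr_inl.2 hk)).trans (hll a' a)
  obtain ⟨c⟩ : Nonempty γ := Fintype.card_pos_iff.1 (by omega)
  obtain ⟨a, -⟩ := hf c
  refine (SimpleGraph.connected_iff_exists_forall_reachable _).2 ⟨.inl a, ?_⟩
  rintro (a' | b)
  · exact hll a a'
  · exact (hrl b a).symm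

end distinctColorGraph

lemma exists_perm_apply_eq_apply_eq {γ : Type*} {i j i' j' : γ} (h : i ≠ j) (h' : i' ≠ j') :
    ∃ σ : Equiv.Perm γ, σ i = i' ∧ σ j = j' := by
  classical
  refine ⟨(Equiv.swap i i').trans (Equiv.swap (Equiv.swap i i' j) j'), ?_, ?_⟩
  · have : Equiv.swap i i' j ≠ i' := fun hj ↦
      h ((Equiv.swap i i').injective ((Equiv.swap_apply_left i i').trans hj.symm))
    simp [Equiv.swap_apply_of_ne_of_ne this.symm h']
  · simp

/-- A permutation of the colours lifts to a bundle with fibre `κ`, with one prescribed value. -/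
lemma exists_perm_lift {α γ κ : Type*} (e : α ≃ γ × κ) (σ : Equiv.Perm γ) {a a' : α}
    (h : σ (e a).1 = (e a').1) :
    ∃ u : Equiv.Perm α, u a = a' ∧ ∀ x, (e (u x)).1 = σ (e x).1 := by
  classical
  refine ⟨(e.trans (Equiv.prodCongr σ (Equiv.swap (e a).2 (e a').2))).trans e.symm, ?_, ?_⟩
  · simp [Equiv.symm_apply_eq, Prod.ext_iff, h]
  · simp

lemma distinctColorGraph.edgeTransitive {α β γ κ μ : Type*} (e : α ≃ γ × κ) (e' : β ≃ γ × μ) :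
    EdgeTransitive (distinctColorGraph (fun a ↦ (e a).1) (fun b ↦ (e' b).1)) := by
  intro e₁ h₁ e₂ h₂
  obtain ⟨a, b, hab, rfl⟩ := exists_of_mem_edgeSet h₁
  obtain ⟨a', b', hab', rfl⟩ := exists_of_mem_edgeSet h₂
  obtain ⟨σ, hσ, hσ'⟩ := exists_perm_apply_eq_apply_eq hab hab'
  obtain ⟨u, rfl, hu⟩ := exists_perm_lift e σ hσ
  obtain ⟨v, rfl, hv⟩ := exists_perm_lift e' σ hσ'
  exact ⟨autOfPerm σ u v hu hv, rfl⟩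

lemma ncard_setOf_fst_ne {α : Type*} {d p : ℕ} (e : α ≃ Fin d × Fin p) (i : Fin d) :
    {a | (e a).1 ≠ i}.ncard = (d - 1) * p := by
  have h : {a | (e a).1 ≠ i} = e ⁻¹' (({i}ᶜ : Set (Fin d)) ×ˢ Set.univ) := by ext; simp
  rw [h, Set.ncard_preimage_of_injective_subset_range e.injective (by simp), Set.ncard_prod,
    Set.ncard_compl, Set.ncard_univ]
  simp

/-- If `gcd(m,n) > 2` then there exists a connected edge-transitive biregular subgraph of
`K_{m,n}` which is not complete (i.e. `r < n`). -/
theorem exists_noncomplete_edgeTransitive_biregular (m n : ℕ) (hm : 0 < m) (hn : 0 < n)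
    (hgcd : 2 < Nat.gcd m n) :
    ∃ r s : ℕ, 0 < r ∧ 0 < s ∧ r < n ∧
      ∃ G : SimpleGraph (Fin m ⊕ Fin n),
        IsBiregularSubgraph m n r s G ∧ G.Connected ∧ EdgeTransitive G := by
  obtain ⟨p, hp⟩ := Nat.gcd_dvd_left m n
  obtain ⟨q, hq⟩ := Nat.gcd_dvd_right m n
  generalize Nat.gcd m n = d at hgcd hp hq
  subst hp hq
  have hp : 0 < p := Nat.pos_of_mul_pos_left hm
  have hq : 0 < q := Nat.pos_of_mul_pos_left hn
  have : NeZero p := ⟨hp.ne'⟩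
  have : NeZero q := ⟨hq.ne'⟩
  let e : Fin (d * p) ≃ Fin d × Fin p := finProdFinEquiv.symm
  let e' : Fin (d * q) ≃ Fin d × Fin q := finProdFinEquiv.symm
  refine ⟨(d - 1) * q, (d - 1) * p, Nat.mul_pos (by omega) hq, Nat.mul_pos (by omega) hp,
    Nat.mul_lt_mul_of_pos_right (by omega) hq,
    distinctColorGraph (fun a ↦ (e a).1) (fun b ↦ (e' b).1), ⟨fun _ _ ↦ id, fun _ _ ↦ id,
      fun a ↦ ?_, fun b ↦ ?_⟩, ?_, distinctColorGraph.edgeTransitive e e'⟩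
  · rw [distinctColorGraph.neighborSet_inl, Set.ncard_image_of_injective _ Sum.inr_injective,
      ncard_setOf_fst_ne]
  · rw [distinctColorGraph.neighborSet_inr, Set.ncard_image_of_injective _ Sum.inl_injective,
      ncard_setOf_fst_ne]
  · exact distinctColorGraph.connected (by simpa) (Prod.fst_surjective.comp e.surjective)
      (Prod.fst_surjective.comp e'.surjective)
end

section
/- Let m ≥ 2, n, and r be positive integers with mr = 2n and r even. Then there exists a connected edge-transitive (r,2) biregular subgraph of K_{m,n}. -/
/-- The bipartite graph on `A ⊕ B` whose edges are the pairs related by `R`. -/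
def bipartiteOfRel {A B : Type*} (R : A → B → Prop) : SimpleGraph (A ⊕ B) where
  Adj
    | Sum.inl a, Sum.inr b => R a b
    | Sum.inr b, Sum.inl a => R a b
    | _, _ => False
  symm := ⟨by rintro (a | b) (a' | b') h <;> exact h⟩
  loopless := ⟨by rintro (a | b) h <;> exact h⟩

section BipartiteOfRel

variable {A B : Type*} {R : A → B → Prop}

theorem bipartiteOfRel_ncard_neighborSet_inl (a : A) :
    ((bipartiteOfRel R).neighborSet (Sum.inl a)).ncard = {b | R a b}.ncard := by
  have h : (bipartiteOfRel R).neighborSet (Sum.inl a) = Sum.inr '' {b | R a b} := by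
    ext (x | x) <;> simp [SimpleGraph.mem_neighborSet, bipartiteOfRel]
  rw [h, Set.ncard_image_of_injective _ Sum.inr_injective]

theorem bipartiteOfRel_ncard_neighborSet_inr (b : B) :
    ((bipartiteOfRel R).neighborSet (Sum.inr b)).ncard = {a | R a b}.ncard := by
  have h : (bipartiteOfRel R).neighborSet (Sum.inr b) = Sum.inl '' {a | R a b} := by
    ext (x | x) <;> simp [SimpleGraph.mem_neighborSet, bipartiteOfRel]
  rw [h, Set.ncard_image_of_injective _ Sum.inl_injective]

/-- Permutations of the two parts that respect `R` induce an automorphism. -/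
def bipartiteOfRelIso (σ : Equiv.Perm A) (τ : Equiv.Perm B)
    (h : ∀ a b, R (σ a) (τ b) ↔ R a b) : bipartiteOfRel R ≃g bipartiteOfRel R where
  toEquiv := Equiv.sumCongr σ τ
  map_rel_iff' := by
    rintro (a | b) (a' | b')
    · exact Iff.rfl
    · exact h a b'
    · exact h a' b
    · exact Iff.rfl

theorem exists_eq_of_mem_edgeSet_bipartiteOfRel {e : Sym2 (A ⊕ B)}
    (he : e ∈ (bipartiteOfRel R).edgeSet) : ∃ a b, R a b ∧ e = s(Sum.inl a, Sum.inr b) := by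
  induction e using Sym2.ind with
  | _ x y =>
    rw [SimpleGraph.mem_edgeSet] at he
    rcases x with a | b <;> rcases y with a' | b'
    · exact he.elim
    · exact ⟨a, b', he, rfl⟩
    · exact ⟨a', b, he, Sym2.eq_swap⟩
    · exact he.elim

theorem edgeTransitive_bipartiteOfRel
    (h : ∀ a b a' b', R a b → R a' b' → ∃ (σ : Equiv.Perm A) (τ : Equiv.Perm B),
      (∀ x y, R (σ x) (τ y) ↔ R x y) ∧ σ a = a' ∧ τ b = b') :
    EdgeTransitive (bipartiteOfRel R) := by
  intro e₁ h₁ e₂ h₂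
  obtain ⟨a, b, hab, rfl⟩ := exists_eq_of_mem_edgeSet_bipartiteOfRel h₁
  obtain ⟨a', b', hab', rfl⟩ := exists_eq_of_mem_edgeSet_bipartiteOfRel h₂
  obtain ⟨σ, τ, hστ, rfl, rfl⟩ := h a b a' b' hab hab'
  exact ⟨bipartiteOfRelIso σ τ hστ, rfl⟩

end BipartiteOfRel

/-- Incidence between the vertices of a directed cycle on `A` and its edges, where the edge from
`i` to `i + 1` occurs once for each element of `K`, and `B` indexes the edges via `e`. -/
def CycleIncidence {A B K : Type*} [AddCommGroup A] [One A] (e : B ≃ A × K) (a : A) (b : B) :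
    Prop :=
  a = (e b).1 ∨ a = (e b).1 + 1

section CycleIncidence

variable {A B K : Type*} [AddCommGroup A] [One A] (e : B ≃ A × K)

theorem ncard_cycleIncidence_left [Finite A] [Fintype K] (h1 : (1 : A) ≠ 0) (a : A) :
    {b | CycleIncidence e a b}.ncard = 2 * Fintype.card K := by
  have h : {b | CycleIncidence e a b} = e.symm '' (({a, a - 1} : Set A) ×ˢ (Set.univ : Set K)) := by
    ext b
    simp [CycleIncidence, Equiv.image_eq_preimage_symm, ← sub_eq_iff_eq_add, eq_comm]
  rw [h, Set.ncard_image_of_injective _ e.symm.injective, Set.ncard_prod,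
    Set.ncard_pair (by simpa [eq_sub_iff_add_eq] using h1), Set.ncard_univ, Nat.card_eq_fintype_card]

theorem ncard_cycleIncidence_right (h1 : (1 : A) ≠ 0) (b : B) :
    {a | CycleIncidence e a b}.ncard = 2 := by
  have h : {a | CycleIncidence e a b} = {(e b).1, (e b).1 + 1} := rfl
  rw [h, Set.ncard_pair (by simpa using h1)]

theorem cycleIncidence_flag_transitive [DecidableEq K] {a a' : A} {b b' : B}
    (h : CycleIncidence e a b) (h' : CycleIncidence e a' b') :
    ∃ (σ : Equiv.Perm A) (τ : Equiv.Perm B),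
      (∀ x y, CycleIncidence e (σ x) (τ y) ↔ CycleIncidence e x y) ∧ σ a = a' ∧ τ b = b' := by
  have rotate (t : A) : ∀ x y, CycleIncidence e (Equiv.addRight t x)
      (e.symm.permCongr ((Equiv.addRight t).prodCongr (Equiv.swap (e b).2 (e b').2)) y) ↔
      CycleIncidence e x y := by
    intro x y
    simp [CycleIncidence, add_right_comm _ t]
  have reflect (c : A) : ∀ x y, CycleIncidence e (Equiv.subLeft (c + 1) x)
      (e.symm.permCongr ((Equiv.subLeft c).prodCongr (Equiv.swap (e b).2 (e b').2)) y) ↔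
      CycleIncidence e x y := by
    intro x y
    have h₁ : c + 1 - x = c - (e y).1 ↔ x = (e y).1 + 1 := by
      constructor <;> intro h <;> grind
    have h₂ : c + 1 - x = c - (e y).1 + 1 ↔ x = (e y).1 := by
      constructor <;> intro h <;> grind
    simp [CycleIncidence, h₁, h₂, or_comm]
  rcases h with rfl | rfl <;> rcases h' with rfl | rfl
  · exact ⟨_, _, rotate ((e b').1 - (e b).1), by simp, by simp [Equiv.symm_apply_eq, Prod.ext_iff]⟩
  · exact ⟨_, _, reflect ((e b').1 + (e b).1), by simp; abel, by simp [Equiv.symm_apply_eq, Prod.ext_iff]⟩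
  · exact ⟨_, _, reflect ((e b').1 + (e b).1), by simp, by simp [Equiv.symm_apply_eq, Prod.ext_iff]⟩
  · exact ⟨_, _, rotate ((e b').1 - (e b).1), by simp; abel, by simp [Equiv.symm_apply_eq, Prod.ext_iff]⟩

theorem connected_bipartiteOfRel_cycleIncidence {m : ℕ} [Nonempty K] (e : B ≃ Fin (m + 1) × K) :
    (bipartiteOfRel (CycleIncidence e)).Connected := by
  have adj_left (b : B) :
      (bipartiteOfRel (CycleIncidence e)).Adj (Sum.inl (e b).1) (Sum.inr b) := Or.inl rfl
  have adj_right (b : B) :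
      (bipartiteOfRel (CycleIncidence e)).Adj (Sum.inl ((e b).1 + 1)) (Sum.inr b) := Or.inr rfl
  have left (a : Fin (m + 1)) :
      (bipartiteOfRel (CycleIncidence e)).Reachable (Sum.inl 0) (Sum.inl a) := by
    induction a using Fin.induction with
    | zero => rfl
    | succ i ih =>
      obtain ⟨j⟩ := ‹Nonempty K›
      have h₁ := adj_left (e.symm (i.castSucc, j))
      have h₂ := adj_right (e.symm (i.castSucc, j))
      simp only [Equiv.apply_symm_apply, Fin.coeSucc_eq_succ] at h₁ h₂
      exact ih.trans (h₁.reachable.trans h₂.symm.reachable)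
  refine SimpleGraph.connected_iff_exists_forall_reachable _ |>.mpr ⟨Sum.inl 0, ?_⟩
  rintro (a | b)
  · exact left a
  · exact (left _).trans (adj_left b).reachable

end CycleIncidence

/-- If `m*r = 2*n` and `r` is even, then there exists a connected edge-transitive
`(r,2)` biregular subgraph of `K_{m,n}`. -/
theorem exists_edgeTransitive_biregular_r_two (m n r : ℕ) (hm : 2 ≤ m) (hn : 0 < n)
    (hr : 0 < r) (hmr : m * r = 2 * n) (hreven : Even r) :
    ∃ G : SimpleGraph (Fin m ⊕ Fin n),
      IsBiregularSubgraph m n r 2 G ∧ G.Connected ∧ EdgeTransitive G := by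
  obtain ⟨k, rfl⟩ := hreven
  obtain ⟨m, rfl⟩ := Nat.exists_eq_add_of_le' hm
  have hk : 0 < k := by omega
  obtain rfl : n = (m + 2) * k := by linarith
  have : Nonempty (Fin k) := ⟨⟨0, hk⟩⟩
  have h1 : (1 : Fin (m + 2)) ≠ 0 := one_ne_zero
  let e : Fin ((m + 2) * k) ≃ Fin (m + 2) × Fin k := finProdFinEquiv.symm
  refine ⟨bipartiteOfRel (CycleIncidence e), ⟨fun _ _ => id, fun _ _ => id, fun a => ?_,
    fun b => ?_⟩, connected_bipartiteOfRel_cycleIncidence e,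
    edgeTransitive_bipartiteOfRel fun _ _ _ _ => cycleIncidence_flag_transitive e⟩
  · rw [bipartiteOfRel_ncard_neighborSet_inl, ncard_cycleIncidence_left e h1, Fintype.card_fin,
      two_mul]
  · rw [bipartiteOfRel_ncard_neighborSet_inr, ncard_cycleIncidence_right e h1]
end

section
/- Let G be a connected edge-transitive (r,2) biregular subgraph of K_{m,n} with parts A (of size m, each vertex of degree r) and B (of size n, each vertex of degree 2). Then for every vertex a ∈ A, the nonzero values among the numbers of common neighbors |N(a) ∩ N(a')|, as a' ranges over A \ {a}, are all equal; that is, there is a positive integer d such that for every a' ∈ A with a' ≠ a, either |N(a) ∩ N(a')| = 0 or |N(a) ∩ N(a')| = d. -/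
theorem Set.eq_pair_of_ncard_eq_two {α : Type*} {s : Set α} {x y : α} (hs : s.ncard = 2)
    (hx : x ∈ s) (hy : y ∈ s) (hxy : x ≠ y) : s = {x, y} := by
  symm
  apply Set.eq_of_subset_of_ncard_le
  · rintro z (rfl | rfl) <;> assumption
  · rw [hs, Set.ncard_pair hxy]
  · exact Set.finite_of_ncard_ne_zero (by omega)

/-- If `a` has neighbors `b₁` and `b₂`, both of degree two, in an edge-transitive graph, then `a`
shares equally many neighbors with the other neighbor of `b₁` and with that of `b₂`. -/
theorem EdgeTransitive.ncard_commonNeighbors_eq {V : Type*} {G : SimpleGraph V}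
    (het : EdgeTransitive G) {a a₁ a₂ b₁ b₂ : V} (h₁ : a₁ ≠ a) (h₂ : a₂ ≠ a)
    (hd₁ : (G.neighborSet b₁).ncard = 2) (hd₂ : (G.neighborSet b₂).ncard = 2)
    (hab₁ : G.Adj a b₁) (ha₁ : G.Adj a₁ b₁) (hab₂ : G.Adj a b₂) (ha₂ : G.Adj a₂ b₂) :
    (G.neighborSet a ∩ G.neighborSet a₁).ncard = (G.neighborSet a ∩ G.neighborSet a₂).ncard := by
  obtain rfl | hne := eq_or_ne a₁ a₂
  · rfl
  have hN₁ := Set.eq_pair_of_ncard_eq_two hd₁ hab₁.symm ha₁.symm h₁.symm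
  have hN₂ := Set.eq_pair_of_ncard_eq_two hd₂ hab₂.symm ha₂.symm h₂.symm
  obtain ⟨φ, hφ⟩ := het s(a, b₁) hab₁ s(a, b₂) hab₂
  rw [Sym2.map_mk, Sym2.eq_iff] at hφ
  obtain ⟨ha, hb⟩ | ⟨ha, -⟩ := hφ
  · have hmem : φ a₁ ∈ G.neighborSet b₂ := hb ▸ φ.map_adj_iff.2 ha₁.symm
    have hφ₁ : φ a₁ = a₂ := by
      rw [hN₂] at hmem
      refine hmem.resolve_left fun h => h₁ (φ.injective (h.trans ha.symm))
    rw [← Set.ncard_image_of_injective _ φ.injective, Set.image_inter φ.injective,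
      φ.image_neighborSet, φ.image_neighborSet, ha, hφ₁]
  · have hda : (G.neighborSet a).ncard = 2 := by
      rw [← Set.ncard_image_of_injective _ φ.injective, φ.image_neighborSet, ha, hd₂]
    have hnb₁ : b₁ ∉ G.neighborSet a₂ := fun h => by
      have : a₂ ∈ G.neighborSet b₁ := G.adj_symm h
      rw [hN₁] at this
      exact this.elim h₂ hne.symm
    have hnb₂ : b₂ ∉ G.neighborSet a₁ := fun h => by
      have : a₁ ∈ G.neighborSet b₂ := G.adj_symm h
      rw [hN₂] at this
      exact this.elim h₁ hne
    have hb : b₁ ≠ b₂ := fun h => hnb₁ (h ▸ ha₂)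
    rw [Set.eq_pair_of_ncard_eq_two hda hab₁ hab₂ hb, Set.insert_inter_of_mem ((G.mem_neighborSet a₁ b₁).2 ha₁),
      Set.singleton_inter_eq_empty.2 hnb₂, Set.insert_inter_of_notMem hnb₁,
      Set.inter_eq_left.2 (Set.singleton_subset_iff.2 ((G.mem_neighborSet a₂ b₂).2 ha₂))]
    simp

/-- In a connected edge-transitive `(r,2)` biregular subgraph of `K_{m,n}`, for every left
vertex `a`, the nonzero numbers of common neighbors `|N(a) ∩ N(a')|` over `a' ≠ a` all take
a single value `d > 0`. -/
theorem edgeTransitive_biregular_uniform_partition (m n r : ℕ) (hm : 2 ≤ m) (hn : 0 < n)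
    (hr : 0 < r) (hmr : m * r = 2 * n) (G : SimpleGraph (Fin m ⊕ Fin n))
    (hbi : IsBiregularSubgraph m n r 2 G) (hconn : G.Connected) (het : EdgeTransitive G) :
    ∀ a : Fin m, ∃ d : ℕ, 0 < d ∧ ∀ a' : Fin m, a' ≠ a →
      (G.neighborSet (Sum.inl a) ∩ G.neighborSet (Sum.inl a')).ncard = 0 ∨
      (G.neighborSet (Sum.inl a) ∩ G.neighborSet (Sum.inl a')).ncard = d := by
  obtain ⟨hleft, -, -, hdeg⟩ := hbi
  intro a
  by_cases h : ∃ a₁ : Fin m, a₁ ≠ a ∧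
      (G.neighborSet (Sum.inl a) ∩ G.neighborSet (Sum.inl a₁)).ncard ≠ 0
  · obtain ⟨a₁, h₁, hc₁⟩ := h
    refine ⟨_, Nat.pos_of_ne_zero hc₁, fun a₂ h₂ => or_iff_not_imp_left.2 fun hc₂ => ?_⟩
    obtain ⟨b₁, hab₁, ha₁⟩ := Set.nonempty_of_ncard_ne_zero hc₁
    obtain ⟨b₂, hab₂, ha₂⟩ := Set.nonempty_of_ncard_ne_zero hc₂
    have hb : ∀ b, G.Adj (Sum.inl a) b → (G.neighborSet b).ncard = 2 := by
      rintro (b | b) hab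
      · exact absurd hab (hleft a b)
      · exact hdeg b
    exact het.ncard_commonNeighbors_eq (Sum.inl_injective.ne h₂) (Sum.inl_injective.ne h₁)
      (hb _ hab₂) (hb _ hab₁) hab₂ ha₂ hab₁ ha₁
  · push Not at h
    exact ⟨1, one_pos, fun a₂ h₂ => Or.inl (h a₂ h₂)⟩
end

section
/- Let n be a positive integer with n ≡ 2 (mod 4) and 6 | n. Then there exists a connected edge-transitive (n/2, 2) biregular subgraph of K_{4,n}, and it is unique up to graph isomorphism. -/
/-- The bipartite incidence graph of a family `f : β → Finset α`. -/
def incidenceGraph {α β : Type*} (f : β → Finset α) : SimpleGraph (α ⊕ β) where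
  Adj
    | .inl a, .inr b => a ∈ f b
    | .inr b, .inl a => a ∈ f b
    | _, _ => False
  symm := ⟨by rintro (a | a) (b | b) h <;> exact h⟩
  loopless := ⟨by rintro (a | a) h <;> exact h⟩

section incidenceGraph

variable {α β : Type*} {f g : β → Finset α}

@[simp] lemma incidenceGraph_adj_inl_inr {a : α} {b : β} :
    (incidenceGraph f).Adj (.inl a) (.inr b) ↔ a ∈ f b := Iff.rfl

@[simp] lemma incidenceGraph_adj_inr_inl {a : α} {b : β} :
    (incidenceGraph f).Adj (.inr b) (.inl a) ↔ a ∈ f b := Iff.rfl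

@[simp] lemma incidenceGraph_adj_inl_inl {a a' : α} :
    ¬ (incidenceGraph f).Adj (.inl a) (.inl a') := id

@[simp] lemma incidenceGraph_adj_inr_inr {b b' : β} :
    ¬ (incidenceGraph f).Adj (.inr b) (.inr b') := id

/-- Compatible bijections of points and indices induce an isomorphism of incidence graphs. -/
def incidenceGraphIso (π : α ≃ α) (σ : β ≃ β) (h : ∀ a b, π a ∈ g (σ b) ↔ a ∈ f b) :
    incidenceGraph f ≃g incidenceGraph g where
  toEquiv := Equiv.sumCongr π σ
  map_rel_iff' := by rintro (a | a) (b | b) <;> simp [h]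

lemma neighborSet_incidenceGraph_inl (a : α) :
    (incidenceGraph f).neighborSet (.inl a) = Sum.inr '' {b | a ∈ f b} := by
  ext (x | x) <;> simp

lemma neighborSet_incidenceGraph_inr (b : β) :
    (incidenceGraph f).neighborSet (.inr b) = Sum.inl '' (f b : Set α) := by
  ext (x | x) <;> simp

lemma ncard_neighborSet_incidenceGraph_inl [Fintype β] [DecidableEq α] (a : α) :
    ((incidenceGraph f).neighborSet (.inl a)).ncard = (Finset.univ.filter (a ∈ f ·)).card := by
  rw [neighborSet_incidenceGraph_inl, Set.ncard_image_of_injective _ Sum.inr_injective,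
    ← Set.ncard_coe_finset]
  simp

lemma ncard_neighborSet_incidenceGraph_inr (b : β) :
    ((incidenceGraph f).neighborSet (.inr b)).ncard = (f b).card := by
  rw [neighborSet_incidenceGraph_inr, Set.ncard_image_of_injective _ Sum.inl_injective,
    Set.ncard_coe_finset]

lemma ncard_twins_incidenceGraph_inr [Fintype β] [DecidableEq α] {b : β} (hb : (f b).Nonempty) :
    {v | (incidenceGraph f).neighborSet v = (incidenceGraph f).neighborSet (.inr b)}.ncard
      = (Finset.univ.filter (f · = f b)).card := by
  rw [← Set.ncard_coe_finset,
    ← Set.ncard_image_of_injective (f := (Sum.inr : β → α ⊕ β)) _ Sum.inr_injective]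
  congr 1
  ext (x | x)
  · obtain ⟨a, ha⟩ := hb
    simp only [Set.mem_ofPred_eq, Set.mem_image, reduceCtorEq, and_false, exists_false, iff_false]
    intro h
    have : Sum.inl a ∈ (incidenceGraph f).neighborSet (.inr b) := ha
    rw [← h] at this
    exact this
  · simp [neighborSet_incidenceGraph_inr, (Set.image_injective.2 Sum.inl_injective).eq_iff]

end incidenceGraph

lemma SimpleGraph.Iso.ncard_neighborSet {V W : Type*} {G : SimpleGraph V} {H : SimpleGraph W}
    (φ : G ≃g H) (v : V) : (H.neighborSet (φ v)).ncard = (G.neighborSet v).ncard := by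
  rw [← φ.image_neighborSet, Set.ncard_image_of_injective _ φ.injective]

lemma SimpleGraph.Iso.ncard_twins {V W : Type*} {G : SimpleGraph V} {H : SimpleGraph W}
    (φ : G ≃g H) (v : V) : {w | H.neighborSet w = H.neighborSet (φ v)}.ncard
      = {w | G.neighborSet w = G.neighborSet v}.ncard := by
  rw [← Set.ncard_image_of_injective _ φ.injective]
  congr 1
  ext w
  obtain ⟨u, rfl⟩ := φ.surjective w
  simp [φ.injective.eq_iff, ← φ.image_neighborSet,
    (Set.image_injective.2 φ.injective).eq_iff]

lemma IsBiregularSubgraph.exists_eq_incidenceGraph {m n r s : ℕ}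
    {G : SimpleGraph (Fin m ⊕ Fin n)} (hG : IsBiregularSubgraph m n r s G) :
    ∃ f : Fin n → Finset (Fin m), G = incidenceGraph f := by
  classical
  refine ⟨fun b => Finset.univ.filter fun a => G.Adj (.inl a) (.inr b), ?_⟩
  ext (a | a) (b | b)
  · simp [hG.1]
  · simp
  · simp [G.adj_comm]
  · simp [hG.2.1]

lemma isBiregularSubgraph_incidenceGraph_iff {m n r s : ℕ} {f : Fin n → Finset (Fin m)} :
    IsBiregularSubgraph m n r s (incidenceGraph f) ↔
      (∀ a, (Finset.univ.filter (a ∈ f ·)).card = r) ∧ ∀ b, (f b).card = s := by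
  simp [IsBiregularSubgraph, ncard_neighborSet_incidenceGraph_inl,
    ncard_neighborSet_incidenceGraph_inr]

/-- In an edge-transitive incidence graph whose two parts have different degrees, all nonempty
fibers of the family have the same size. -/
lemma EdgeTransitive.card_fiber_eq {m n r s : ℕ} {f : Fin n → Finset (Fin m)} (hrs : r ≠ s)
    (hs : 0 < s) (hf : IsBiregularSubgraph m n r s (incidenceGraph f))
    (he : EdgeTransitive (incidenceGraph f)) (b b' : Fin n) :
    (Finset.univ.filter (f · = f b)).card = (Finset.univ.filter (f · = f b')).card := by
  have hne (b : Fin n) : (f b).Nonempty := by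
    have := (isBiregularSubgraph_incidenceGraph_iff.1 hf).2 b
    exact Finset.card_pos.1 (by omega)
  obtain ⟨a, ha⟩ := hne b
  obtain ⟨a', ha'⟩ := hne b'
  obtain ⟨φ, hφ⟩ := he s(.inl a, .inr b) ha s(.inl a', .inr b') ha'
  rw [Sym2.map_mk, Sym2.eq_iff] at hφ
  rcases hφ with ⟨-, h⟩ | ⟨h, -⟩
  · rw [← ncard_twins_incidenceGraph_inr (hne b), ← ncard_twins_incidenceGraph_inr (hne b'),
      ← φ.ncard_twins, h]
  · have := φ.ncard_neighborSet (.inl a)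
    rw [h, hf.2.2.1, hf.2.2.2] at this
    exact absurd this.symm hrs

/-- If every point lies in exactly one member of the range of `f`, then connectedness of the
incidence graph forces each member to contain all points. -/
lemma mem_of_preconnected_incidenceGraph {α β : Type*} {f : β → Finset α}
    (hc : (incidenceGraph f).Preconnected) {b₀ : β} {a₀ : α} (ha₀ : a₀ ∈ f b₀)
    (h : ∀ a b b', a ∈ f b → a ∈ f b' → f b = f b') (a : α) : a ∈ f b₀ := by
  let S : α ⊕ β → Prop := Sum.elim (· ∈ f b₀) (f · = f b₀)
  have key : ∀ u v, (incidenceGraph f).Walk u v → S u → S v := by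
    intro u v p
    induction p with
    | nil => exact id
    | @cons u v w huv _ ih =>
      refine fun hu => ih ?_
      rcases u with x | x <;> rcases v with y | y
      · exact huv.elim
      · exact h x y b₀ huv hu
      · have hx : f x = f b₀ := hu
        have hy : y ∈ f x := huv
        exact show y ∈ f b₀ from hx ▸ hy
      · exact huv.elim
  obtain ⟨p⟩ := hc (.inl a₀) (.inl a)
  exact key _ _ p ha₀

lemma card_fiber_of_edgeTransitive {n : ℕ} (hn : 0 < n) (h4 : n % 4 = 2) (h6 : 6 ∣ n)
    {f : Fin n → Finset (Fin 4)} (hf : IsBiregularSubgraph 4 n (n / 2) 2 (incidenceGraph f))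
    (hc : (incidenceGraph f).Connected) (he : EdgeTransitive (incidenceGraph f))
    {s : Finset (Fin 4)} (hs : s.card = 2) :
    (Finset.univ.filter (f · = s)).card = n / 6 := by
  have hfib := he.card_fiber_eq (by omega) two_pos hf
  obtain ⟨hdeg, hcard⟩ := isBiregularSubgraph_incidenceGraph_iff.1 hf
  let b₀ : Fin n := ⟨0, hn⟩
  set c := (Finset.univ.filter (f · = f b₀)).card with hcdef
  let D (a : Fin 4) : Finset (Finset (Fin 4)) := (Finset.univ.image f).filter (a ∈ ·)
  let P (a : Fin 4) : Finset (Finset (Fin 4)) := (Finset.powersetCard 2 Finset.univ).filter (a ∈ ·)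
  have hP (a : Fin 4) : (P a).card = 3 := by revert a; decide
  have hDP (a : Fin 4) : D a ⊆ P a := by
    intro t ht
    simp only [D, P, Finset.mem_filter, Finset.mem_image, Finset.mem_univ, true_and,
      Finset.mem_powersetCard, Finset.subset_univ] at ht ⊢
    obtain ⟨⟨b, rfl⟩, h⟩ := ht
    exact ⟨hcard b, h⟩
  have hDc (a : Fin 4) : (D a).card * c = n / 2 := by
    rw [← hdeg a, Finset.card_eq_sum_card_fiberwise (f := f) (t := D a)]
    · rw [← smul_eq_mul, ← Finset.sum_const]
      refine Finset.sum_congr rfl fun t ht => ?_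
      simp only [D, Finset.mem_filter, Finset.mem_image, Finset.mem_univ, true_and] at ht
      obtain ⟨⟨b, rfl⟩, h⟩ := ht
      rw [hcdef, hfib b₀ b]
      congr 1
      ext x
      simp only [Finset.mem_filter, Finset.mem_univ, true_and]
      exact ⟨fun hx => ⟨hx ▸ h, hx⟩, fun hx => hx.2⟩
    · intro b hb
      simp only [D, Finset.coe_filter, Finset.mem_image, Finset.mem_univ, true_and,
        Set.mem_ofPred_eq] at hb ⊢
      exact ⟨⟨b, rfl⟩, hb⟩
  have hcpos : 0 < c := by
    rcases Nat.eq_zero_or_pos c with h | h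
    · have := hDc 0
      rw [h] at this
      omega
    · exact h
  have hDeq (a : Fin 4) : (D a).card = (D 0).card :=
    Nat.eq_of_mul_eq_mul_right hcpos ((hDc a).trans (hDc 0).symm)
  have hD0 : (D 0).card ≤ 3 := (Finset.card_le_card (hDP 0)).trans_eq (hP 0)
  have hD1 : (D 0).card ≠ 1 := by
    intro h1
    obtain ⟨a₀, ha₀⟩ : (f b₀).Nonempty := Finset.card_pos.1 (by rw [hcard]; omega)
    have := mem_of_preconnected_incidenceGraph hc.preconnected ha₀ (fun a b b' hb hb' =>
      Finset.card_le_one.1 (((hDeq a).trans h1).le) _ (by simp [D, hb]) _ (by simp [D, hb']))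
    have h2 := hcard b₀
    rw [Finset.eq_univ_iff_forall.2 this] at h2
    simp at h2
  have hD3 : (D 0).card = 3 := by
    have := hDc 0
    interval_cases (D 0).card <;> omega
  obtain ⟨a, ha⟩ : s.Nonempty := Finset.card_pos.1 (by omega)
  have hsD : s ∈ D a := by
    rw [Finset.eq_of_subset_of_card_le (hDP a) (by rw [hP, hDeq, hD3])]
    simp [P, hs, ha]
  simp only [D, Finset.mem_filter, Finset.mem_image, Finset.mem_univ, true_and] at hsD
  obtain ⟨⟨b, rfl⟩, -⟩ := hsD
  rw [← hfib b₀ b]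
  have := hDc 0
  rw [hD3] at this
  omega

/-- Two families with equal fiber sizes differ by a permutation of the indices. -/
lemma exists_perm_of_card_fiber_eq {β γ : Type*} [Fintype β] [DecidableEq γ] {f g : β → γ}
    (h : ∀ c, (Finset.univ.filter (f · = c)).card = (Finset.univ.filter (g · = c)).card) :
    ∃ σ : Equiv.Perm β, ∀ b, g (σ b) = f b := by
  have e : ∀ c, Nonempty ({b // f b = c} ≃ {b // g b = c}) := fun c =>
    ⟨Fintype.equivOfCardEq (by rw [Fintype.card_subtype, Fintype.card_subtype, h c])⟩
  replace e := fun c => (e c).some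
  refine ⟨(Equiv.sigmaFiberEquiv f).symm.trans
    ((Equiv.sigmaCongrRight e).trans (Equiv.sigmaFiberEquiv g)), fun b => ?_⟩
  exact (e (f b) ⟨b, rfl⟩).2

lemma exists_eq_pair_of_mem {α : Type*} [DecidableEq α] {s : Finset α} (hs : s.card = 2) {a : α}
    (ha : a ∈ s) : ∃ c, a ≠ c ∧ s = {a, c} := by
  obtain ⟨x, y, hxy, rfl⟩ := Finset.card_eq_two.1 hs
  rcases Finset.mem_insert.1 ha with rfl | h
  · exact ⟨y, hxy, rfl⟩
  · rw [Finset.mem_singleton.1 h]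
    exact ⟨x, hxy.symm, Finset.pair_comm _ _⟩

lemma exists_perm_map_pair {α : Type*} [DecidableEq α] {a c a' c' : α} (h : a ≠ c)
    (h' : a' ≠ c') : ∃ π : Equiv.Perm α, π a = a' ∧ π c = c' := by
  refine ⟨(Equiv.swap a a').trans (Equiv.swap (Equiv.swap a a' c) c'), ?_, by simp⟩
  have : Equiv.swap a a' c ≠ a' := by
    rw [Ne, Equiv.swap_apply_eq_iff, Equiv.swap_apply_right]
    exact h.symm
  simp [Equiv.swap_apply_of_ne_of_ne this.symm h']

/-- The incidence graph of the family containing each pair of points equally often is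
edge-transitive. -/
lemma edgeTransitive_incidenceGraph_pairs {α β κ : Type*} [DecidableEq α] [DecidableEq κ]
    (e : β ≃ {s : Finset α // s.card = 2} × κ) :
    EdgeTransitive (incidenceGraph fun b => (e b).1.1) := by
  have flag : ∀ x ∈ (incidenceGraph fun b => (e b).1.1).edgeSet,
      ∃ a b, a ∈ (e b).1.1 ∧ x = s(.inl a, .inr b) := by
    intro x
    induction x with
    | _ u v =>
      rcases u with a | a <;> rcases v with b | b <;> intro h
      · exact h.elim
      · exact ⟨a, b, h, rfl⟩
      · exact ⟨b, a, h, Sym2.eq_swap⟩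
      · exact h.elim
  intro x hx y hy
  obtain ⟨a, b, hab, rfl⟩ := flag x hx
  obtain ⟨a', b', hab', rfl⟩ := flag y hy
  obtain ⟨c, hc⟩ := exists_eq_pair_of_mem (e b).1.2 hab
  obtain ⟨c', hc'⟩ := exists_eq_pair_of_mem (e b').1.2 hab'
  obtain ⟨π, hπ, hπ'⟩ := exists_perm_map_pair hc.1 hc'.1
  let ρ : Equiv.Perm {s : Finset α // s.card = 2} :=
    π.finsetCongr.subtypeEquiv fun s => by simp
  let σ : Equiv.Perm β :=
    e.trans ((Equiv.prodCongr ρ (Equiv.swap (e b).2 (e b').2)).trans e.symm)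
  refine ⟨incidenceGraphIso π σ fun a b => by simp [σ, ρ], ?_⟩
  have hσ : σ b = b' := by
    simp only [σ, Equiv.trans_apply, Equiv.symm_apply_eq]
    refine Prod.ext (Subtype.ext ?_) (by simp)
    simp [ρ, hc.2, hc'.2, hπ, hπ']
  change s(Sum.inl (π a), Sum.inr (σ b)) = _
  rw [hσ, hπ]

/-- If `n ≡ 2 (mod 4)` and `6 ∣ n`, then there exists a connected edge-transitive
`(n/2, 2)` biregular subgraph of `K_{4,n}`, unique up to isomorphism. -/
theorem unique_edgeTransitive_biregular_K4n (n : ℕ) (hn : 0 < n) (h4 : n % 4 = 2)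
    (h6 : 6 ∣ n) :
    ∃ G : SimpleGraph (Fin 4 ⊕ Fin n),
      (IsBiregularSubgraph 4 n (n / 2) 2 G ∧ G.Connected ∧ EdgeTransitive G) ∧
      ∀ G' : SimpleGraph (Fin 4 ⊕ Fin n),
        IsBiregularSubgraph 4 n (n / 2) 2 G' ∧ G'.Connected ∧ EdgeTransitive G' →
          Nonempty (G ≃g G') := by
  obtain ⟨k, rfl⟩ := h6
  have e : Fin (6 * k) ≃ {s : Finset (Fin 4) // s.card = 2} × Fin k :=
    Fintype.equivOfCardEq (by simp [Fintype.card_finset_len, Nat.choose])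
  let f : Fin (6 * k) → Finset (Fin 4) := fun b => (e b).1.1
  have hk : 0 < k := by omega
  have hfib (s : Finset (Fin 4)) (hs : s.card = 2) : (Finset.univ.filter (f · = s)).card = k := by
    refine ((Finset.card_fin k).symm.trans
      (Finset.card_bij (fun i _ => e.symm (⟨s, hs⟩, i)) (by simp [f]) (by simp) ?_)).symm
    intro b hb
    refine ⟨(e b).2, by simp, ?_⟩
    rw [Equiv.symm_apply_eq]
    exact Prod.ext (Subtype.ext ((Finset.mem_filter.1 hb).2.symm)) rfl
  have hbi : IsBiregularSubgraph 4 (6 * k) (6 * k / 2) 2 (incidenceGraph f) := by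
    refine isBiregularSubgraph_incidenceGraph_iff.2 ⟨fun a => ?_, fun b => (e b).1.2⟩
    let P := (Finset.powersetCard 2 (Finset.univ : Finset (Fin 4))).filter (a ∈ ·)
    have hP : P.card = 3 := by revert a; decide
    have hsum : ∀ t ∈ P, ((Finset.univ.filter (a ∈ f ·)).filter (f · = t)).card = k := by
      intro t ht
      simp only [P, Finset.mem_filter, Finset.mem_powersetCard] at ht
      refine Eq.trans (congrArg Finset.card ?_) (hfib t ht.1.2)
      rw [Finset.filter_filter]
      ext x
      simp only [Finset.mem_filter, Finset.mem_univ, true_and]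
      exact ⟨fun hx => hx.2, fun hx => ⟨hx ▸ ht.2, hx⟩⟩
    rw [Finset.card_eq_sum_card_fiberwise (f := f) (t := P), Finset.sum_congr rfl hsum,
      Finset.sum_const, hP, smul_eq_mul]
    · omega
    · intro b hb
      simp only [P, Finset.coe_filter, Finset.mem_univ, true_and, Set.mem_ofPred_eq,
        Finset.mem_powersetCard, Finset.subset_univ] at hb ⊢
      exact ⟨(e b).1.2, hb⟩
  have hconn : (incidenceGraph f).Connected := by
    have hinl (a a' : Fin 4) : (incidenceGraph f).Reachable (.inl a) (.inl a') := by
      by_cases h : a = a'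
      · rw [h]
      let b := e.symm (⟨{a, a'}, Finset.card_pair h⟩, ⟨0, hk⟩)
      have h1 : (incidenceGraph f).Adj (.inl a) (.inr b) := by simp [f, b]
      have h2 : (incidenceGraph f).Adj (.inr b) (.inl a') := by simp [f, b]
      exact h1.reachable.trans h2.reachable
    have hzero (v : Fin 4 ⊕ Fin (6 * k)) : (incidenceGraph f).Reachable v (.inl 0) := by
      rcases v with a | b
      · exact hinl a 0
      · obtain ⟨a, ha⟩ : (f b).Nonempty := Finset.card_pos.1 (by rw [(e b).1.2]; omega)
        have h : (incidenceGraph f).Adj (.inr b) (.inl a) := ha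
        exact h.reachable.trans (hinl a 0)
    exact ⟨fun u v => (hzero u).trans (hzero v).symm⟩
  refine ⟨incidenceGraph f, ⟨hbi, hconn, edgeTransitive_incidenceGraph_pairs e⟩, ?_⟩
  rintro G' ⟨hG, hc, he⟩
  obtain ⟨g, rfl⟩ := hG.exists_eq_incidenceGraph
  have hg := (isBiregularSubgraph_incidenceGraph_iff.1 hG).2
  obtain ⟨σ, hσ⟩ := exists_perm_of_card_fiber_eq (f := f) (g := g) fun s => by
    by_cases hs : s.card = 2
    · rw [hfib s hs, card_fiber_of_edgeTransitive hn h4 ⟨k, rfl⟩ hG hc he hs]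
      omega
    · rw [Finset.filter_eq_empty_iff.2 fun b _ (h : f b = s) => hs (h ▸ (e b).1.2),
        Finset.filter_eq_empty_iff.2 fun b _ (h : g b = s) => hs (h ▸ hg b)]
  exact ⟨incidenceGraphIso (Equiv.refl _) σ fun a b => by simp [hσ]⟩
end

section
/- For all positive integers m and n, the complement of the Cartesian (box) product K_m □ K_n of complete graphs is edge-transitive. -/
/-- Any two distinct points can be carried to any two distinct points by a permutation. -/
theorem exists_perm_apply_eq_and_apply_eq {α : Type*} {a b c d : α} (hab : a ≠ b) (hcd : c ≠ d) :
    ∃ σ : Equiv.Perm α, σ a = c ∧ σ b = d := by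
  classical
  have h : c ≠ Equiv.swap a c b := fun h => hab <| (Equiv.swap a c).injective <| by
    rw [Equiv.swap_apply_left, ← h]
  exact ⟨Equiv.swap (Equiv.swap a c b) d * Equiv.swap a c, by
    simp [Equiv.swap_apply_of_ne_of_ne h hcd], by simp⟩

theorem compl_boxProd_top_adj {α β : Type*} {x y : α × β} :
    (((⊤ : SimpleGraph α).boxProd (⊤ : SimpleGraph β))ᶜ).Adj x y ↔ x.1 ≠ y.1 ∧ x.2 ≠ y.2 := by
  simp only [SimpleGraph.compl_adj, SimpleGraph.boxProd_adj, SimpleGraph.top_adj, ne_eq,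
    Prod.ext_iff]
  tauto

/-- Permutations of the two coordinates act on the complement of a box product of complete graphs
by automorphisms. -/
def complBoxProdTopIso {α β : Type*} (σ : Equiv.Perm α) (τ : Equiv.Perm β) :
    ((⊤ : SimpleGraph α).boxProd (⊤ : SimpleGraph β))ᶜ ≃g
      ((⊤ : SimpleGraph α).boxProd (⊤ : SimpleGraph β))ᶜ where
  toEquiv := σ.prodCongr τ
  map_rel_iff' := by simp

/-- The complement of the Cartesian (box) product `K_m □ K_n` is edge-transitive. -/
theorem compl_boxProd_complete_edgeTransitive (m n : ℕ) (hm : 0 < m) (hn : 0 < n) :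
    EdgeTransitive (((⊤ : SimpleGraph (Fin m)).boxProd (⊤ : SimpleGraph (Fin n)))ᶜ) := by
  rintro ⟨x, y⟩ hxy ⟨z, w⟩ hzw
  obtain ⟨h₁, h₂⟩ := compl_boxProd_top_adj.1 hxy
  obtain ⟨h₃, h₄⟩ := compl_boxProd_top_adj.1 hzw
  obtain ⟨σ, hσx, hσy⟩ := exists_perm_apply_eq_and_apply_eq h₁ h₃
  obtain ⟨τ, hτx, hτy⟩ := exists_perm_apply_eq_and_apply_eq h₂ h₄
  exact ⟨complBoxProdTopIso σ τ,
    congrArg₂ (fun u v => s(u, v)) (Prod.ext hσx hτx) (Prod.ext hσy hτy)⟩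
end

section
/- Let n ≥ 3 and k ≥ 2 be integers. The k-th power of the cycle, C_n^k = C_n({1,2,…,k}), is edge-transitive if and only if k ≥ ⌊n/2⌋, or n is even and k = n/2 − 1. -/
/-- The circulant graph `C_n(L)` on vertex set `ZMod n`: distinct vertices `x`, `y` are
adjacent iff `x - y ≡ ±l (mod n)` for some `l ∈ L`. -/
def circulant (n : ℕ) (L : Finset ℤ) : SimpleGraph (ZMod n) :=
  SimpleGraph.circulantGraph {x : ZMod n | ∃ l ∈ L, x = (l : ZMod n)}

/-- If adjacency means being neither equal nor matched by `σ`, where the involution `σ` is trivial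
or fixed-point-free, then any vertex can be moved to any other one by an automorphism moving only
these two vertices and their partners. -/
theorem exists_iso_of_adj_iff_ne_involutive {V : Type*} {G : SimpleGraph V} {σ : V → V}
    (hσ : Function.Involutive σ) (hfix : (∀ x, σ x = x) ∨ ∀ x, σ x ≠ x)
    (hG : ∀ x y, G.Adj x y ↔ x ≠ y ∧ x ≠ σ y) (u v : V) :
    ∃ φ : G ≃g G, φ u = v ∧ ∀ w, w ≠ u → w ≠ v → w ≠ σ u → w ≠ σ v → φ w = w := by
  classical
  let f : V → V := fun x =>
    if x = u then v else if x = v then u else if x = σ u then σ v else if x = σ v then σ u else x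
  have hσσ : ∀ x, σ (σ x) = x := hσ
  have hf : Function.Involutive f := by
    intro x
    simp only [f]
    grind
  have hcomm : ∀ x, f (σ x) = σ (f x) := by
    intro x
    simp only [f]
    grind
  refine ⟨⟨hf.toPerm f, ?_⟩, ?_, ?_⟩
  · intro x y
    simp only [Function.Involutive.coe_toPerm, hG, ← hcomm, ne_eq, hf.injective.eq_iff]
  · simp [f]
  · intro w h₁ h₂ h₃ h₄
    simp [f, h₁, h₂, h₃, h₄]

theorem edgeTransitive_of_adj_iff_ne_involutive {V : Type*} {G : SimpleGraph V} {σ : V → V}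
    (hσ : Function.Involutive σ) (hfix : (∀ x, σ x = x) ∨ ∀ x, σ x ≠ x)
    (hG : ∀ x y, G.Adj x y ↔ x ≠ y ∧ x ≠ σ y) : EdgeTransitive G := by
  intro e₁ he₁ e₂ he₂
  induction e₁ with | _ a b
  induction e₂ with | _ c d
  rw [SimpleGraph.mem_edgeSet] at he₁ he₂
  obtain ⟨φ, hφ, -⟩ := exists_iso_of_adj_iff_ne_involutive hσ hfix hG a c
  obtain ⟨ψ, hψ, hψfix⟩ := exists_iso_of_adj_iff_ne_involutive hσ hfix hG (φ b) d
  have hcb : G.Adj c (φ b) := hφ ▸ φ.map_adj_iff.2 he₁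
  rw [hG] at hcb he₂
  refine ⟨φ.trans ψ, ?_⟩
  simp [hφ, hψ, hψfix c hcb.1 he₂.1 hcb.2 he₂.2]

theorem circulant_Icc_adj {n k : ℕ} {x y : ZMod n} :
    (circulant n (Finset.Icc (1 : ℤ) (k : ℤ))).Adj x y ↔
      x ≠ y ∧ ∃ l : ℤ, 1 ≤ l ∧ l ≤ k ∧ (x - y = l ∨ y - x = l) := by
  simp only [circulant, SimpleGraph.circulantGraph, SimpleGraph.fromRel_adj, Set.mem_ofPred_eq,
    Finset.mem_Icc]
  grind

theorem circulant_Icc_not_adj {n k : ℕ} {x y : ZMod n} {d : ℤ} (hd : x - y = d) (hkd : k < d)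
    (hdn : d < n - k) : ¬ (circulant n (Finset.Icc (1 : ℤ) (k : ℤ))).Adj x y := by
  rw [circulant_Icc_adj]
  rintro ⟨-, l, hl₁, hlk, h | h⟩
  · rw [hd, ← sub_eq_zero, ← Int.cast_sub, ZMod.intCast_zmod_eq_zero_iff_dvd] at h
    have := Int.le_of_dvd (by omega) h
    omega
  · rw [← neg_sub, hd, ← sub_eq_zero, ← Int.cast_neg, ← Int.cast_sub,
      ZMod.intCast_zmod_eq_zero_iff_dvd, ← dvd_neg] at h
    have := Int.le_of_dvd (by omega) h
    omega

theorem circulant_Icc_adj_of_val {n k : ℕ} [NeZero n] {x y : ZMod n} (hxy : x ≠ y)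
    (h : (x - y).val ≤ k ∨ n ≤ (x - y).val + k) :
    (circulant n (Finset.Icc (1 : ℤ) (k : ℤ))).Adj x y := by
  have hpos : (x - y).val ≠ 0 := by simpa [sub_eq_zero] using hxy
  have hlt := ZMod.val_lt (x - y)
  rw [circulant_Icc_adj]
  refine ⟨hxy, ?_⟩
  rcases h with h | h
  · exact ⟨(x - y).val, by omega, by omega, .inl (by simp)⟩
  · exact ⟨n - (x - y).val, by omega, by omega, .inr (by simp)⟩

theorem cyclePower_edgeTransitive_of_half_le {n k : ℕ} [NeZero n] (h : n / 2 ≤ k) :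
    EdgeTransitive (circulant n (Finset.Icc (1 : ℤ) (k : ℤ))) := by
  refine edgeTransitive_of_adj_iff_ne_involutive (σ := id) (fun _ => rfl) (.inl fun _ => rfl) ?_
  intro x y
  simp only [id, and_self]
  exact ⟨SimpleGraph.Adj.ne, fun hxy => circulant_Icc_adj_of_val hxy (by omega)⟩

theorem cyclePower_edgeTransitive_of_eq_two_mul_add_two (k : ℕ) :
    EdgeTransitive (circulant (2 * k + 2) (Finset.Icc (1 : ℤ) (k : ℤ))) := by
  have hdouble : ((k + 1 : ℕ) : ZMod (2 * k + 2)) + (k + 1 : ℕ) = 0 := by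
    rw [← Nat.cast_add, ZMod.natCast_eq_zero_iff]
    exact ⟨1, by ring⟩
  have hval : ((k + 1 : ℕ) : ZMod (2 * k + 2)).val = k + 1 := ZMod.val_natCast_of_lt (by omega)
  refine edgeTransitive_of_adj_iff_ne_involutive (σ := fun x => x + (k + 1 : ℕ)) ?_ (.inr ?_) ?_
  · intro x
    simp only [add_assoc, hdouble, add_zero]
  · intro x hx
    rw [add_eq_left] at hx
    simp [hx] at hval
  · intro x y
    refine ⟨fun hxy => ⟨hxy.ne, fun h => ?_⟩, fun ⟨hxy, h⟩ => circulant_Icc_adj_of_val hxy ?_⟩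
    · refine circulant_Icc_not_adj (d := k + 1) ?_ (by omega) (by push_cast; omega) hxy
      rw [h]
      push_cast
      ring
    · by_contra! hlt
      apply h
      have : (x - y).val = k + 1 := by omega
      rw [← this, ZMod.natCast_zmod_val, add_sub_cancel]

theorem cyclePower_not_edgeTransitive {n k : ℕ} (hk : 2 ≤ k) (hn : 2 * k + 3 ≤ n) :
    ¬ EdgeTransitive (circulant n (Finset.Icc (1 : ℤ) (k : ℤ))) := by
  intro h
  have hcast {d : ℤ} (h₀ : 0 < d) (h₁ : d < n) : (d : ZMod n) ≠ 0 := by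
    rw [ne_eq, ZMod.intCast_zmod_eq_zero_iff_dvd]
    exact fun hd => absurd (Int.le_of_dvd h₀ hd) (by omega)
  have hone : (1 : ZMod n) ≠ 0 := by simpa using hcast (d := 1) (by omega) (by omega)
  have htwo : (2 : ZMod n) ≠ 0 := by simpa using hcast (d := 2) (by omega) (by omega)
  have hkne : (k : ZMod n) ≠ 0 := by simpa using hcast (d := k) (by omega) (by omega)
  set G := circulant n (Finset.Icc (1 : ℤ) (k : ℤ))
  have h₁ : G.Adj 0 1 := circulant_Icc_adj.2 ⟨hone.symm, 1, by simp; omega⟩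
  have h₂ : G.Adj 0 k := circulant_Icc_adj.2 ⟨hkne.symm, k, by simp; omega⟩
  obtain ⟨φ, hφ⟩ := h s(0, (k : ZMod n)) h₂ s(0, 1) h₁
  have hkadj₁ : ¬ G.Adj k (-1) := circulant_Icc_not_adj (d := k + 1) (by simp) (by omega) (by omega)
  have hkadj₂ : ¬ G.Adj k (-2) := circulant_Icc_not_adj (d := k + 2) (by simp) (by omega) (by omega)
  have hadj₁ : G.Adj 0 (-1) := circulant_Icc_adj.2 ⟨by simpa using hone, 1, by simp; omega⟩
  have hadj₂ : G.Adj 0 (-2) := circulant_Icc_adj.2 ⟨by simpa using htwo, 2, by simp; omega⟩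
  have hne₁ : (k : ZMod n) ≠ -1 := fun h => by
    apply hcast (d := k + 1) (by omega) (by omega)
    simp [h]
  have hne₂ : (k : ZMod n) ≠ -2 := fun h => by
    apply hcast (d := k + 2) (by omega) (by omega)
    simp [h]
  have huniq₀ {x : ZMod n} (h₀ : G.Adj 0 x) (h₁ : ¬ G.Adj 1 x) (hx : 1 ≠ x) : x = -k := by
    obtain ⟨-, l, hl₁, hlk, hl | hl⟩ := circulant_Icc_adj.1 h₀
    · rcases hlk.eq_or_lt with rfl | hlk
      · simpa [neg_eq_iff_eq_neg] using hl
      · refine absurd (circulant_Icc_adj.2 ⟨hx, l + 1, by omega, by omega, .inl ?_⟩) h₁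
        push_cast
        rw [← hl]
        ring
    · rcases hl₁.eq_or_lt with rfl | hl₁
      · exact absurd (by simpa using hl.symm) hx
      · refine absurd (circulant_Icc_adj.2 ⟨hx, l - 1, by omega, by omega, .inr ?_⟩) h₁
        push_cast
        rw [← hl]
        ring
  have huniq₁ {x : ZMod n} (h₁ : G.Adj 1 x) (h₀ : ¬ G.Adj 0 x) (hx : 0 ≠ x) : x = k + 1 := by
    obtain ⟨-, l, hl₁, hlk, hl | hl⟩ := circulant_Icc_adj.1 h₁
    · rcases hl₁.eq_or_lt with rfl | hl₁
      · exact absurd (sub_eq_self.1 (hl.trans Int.cast_one)).symm hx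
      · refine absurd (circulant_Icc_adj.2 ⟨hx, l - 1, by omega, by omega, .inl ?_⟩) h₀
        push_cast
        rw [← hl]
        ring
    · rcases hlk.eq_or_lt with rfl | hlk
      · simpa [sub_eq_iff_eq_add] using hl
      · refine absurd (circulant_Icc_adj.2 ⟨hx, l + 1, by omega, by omega, .inr ?_⟩) h₀
        push_cast
        rw [← hl]
        ring
  have hφne : φ (-1) ≠ φ (-2) := fun h => hone <| by
    linear_combination φ.injective h
  rw [← φ.map_adj_iff] at hkadj₁ hkadj₂ hadj₁ hadj₂
  rw [← φ.injective.ne_iff] at hne₁ hne₂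
  rw [Sym2.map_mk, Sym2.eq_iff] at hφ
  rcases hφ with ⟨h0, hk⟩ | ⟨h0, hk⟩ <;> rw [h0] at hadj₁ hadj₂ <;>
    rw [hk] at hkadj₁ hkadj₂ hne₁ hne₂
  · exact hφne ((huniq₀ hadj₁ hkadj₁ hne₁).trans (huniq₀ hadj₂ hkadj₂ hne₂).symm)
  · exact hφne ((huniq₁ hadj₁ hkadj₁ hne₁).trans (huniq₁ hadj₂ hkadj₂ hne₂).symm)

/-- The `k`-th power of the cycle `C_n^k = C_n({1,...,k})` is edge-transitive if and only if
`k ≥ ⌊n/2⌋`, or `n` is even and `k = n/2 - 1`. -/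
theorem cyclePower_edgeTransitive_iff (n k : ℕ) (hn : 3 ≤ n) (hk : 2 ≤ k) :
    EdgeTransitive (circulant n (Finset.Icc (1 : ℤ) (k : ℤ))) ↔
      (n / 2 ≤ k ∨ (Even n ∧ k = n / 2 - 1)) := by
  constructor
  · intro h
    by_contra! hcon
    refine cyclePower_not_edgeTransitive hk ?_ h
    obtain ⟨hlt, heven⟩ := hcon
    rcases Nat.even_or_odd' n with ⟨m, rfl | rfl⟩
    · have := heven (even_two_mul m)
      omega
    · omega
  · rintro (h | ⟨⟨m, rfl⟩, h⟩)
    · have : NeZero n := ⟨by omega⟩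
      exact cyclePower_edgeTransitive_of_half_le h
    · obtain rfl : m = k + 1 := by omega
      rw [show k + 1 + (k + 1) = 2 * k + 2 by ring]
      exact cyclePower_edgeTransitive_of_eq_two_mul_add_two k
end

section
/- Let n ≥ 5 be an integer, let S = {2, 3, …, ⌈n/2⌉ − 1}, let i be an integer with i ∈ S and i+1 ∈ S, and let S' be any subset of S. Then the circulant graph C_{2n}(A) with connection set A = {1, i, i+1, n} ∪ S' is not edge-transitive. -/
theorem circulant_adj_iff {n : ℕ} {L : Finset ℤ} {x y : ZMod n} :
    (circulant n L).Adj x y ↔ x ≠ y ∧ ∃ l ∈ L, x - y = (l : ZMod n) ∨ y - x = (l : ZMod n) := by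
  simp only [circulant, SimpleGraph.circulantGraph_adj, Set.mem_ofPred_eq]
  grind

/-- If every jump other than `n` is less than `n / 2`, then two vertices of `C_{2n}(L)` whose
difference is `n` have no common neighbour. -/
theorem not_adj_add_half_of_adj {n : ℕ} {L : Finset ℤ}
    (hL : ∀ l ∈ L, l = n ∨ |2 * l| < (n : ℤ)) {x w : ZMod (2 * n)}
    (hx : (circulant (2 * n) L).Adj w x) :
    ¬ (circulant (2 * n) L).Adj w (x + (n : ZMod (2 * n))) := by
  have hnn : (n : ZMod (2 * n)) + n = 0 := by
    have := ZMod.natCast_self (2 * n)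
    push_cast at this
    linear_combination this
  have key : ∀ {u v : ZMod (2 * n)}, (circulant (2 * n) L).Adj u v →
      u = v + n ∨ ∃ k : ℤ, u - v = k ∧ |2 * k| < (n : ℤ) := by
    intro u v h
    obtain ⟨-, l, hl, h⟩ := circulant_adj_iff.1 h
    rcases hL l hl with rfl | hlt
    · left
      push_cast at h
      rcases h with h | h
      · linear_combination h
      · linear_combination -h - hnn
    · right
      rcases h with h | h
      · exact ⟨l, h, hlt⟩
      · exact ⟨-l, by push_cast; linear_combination -h, by rwa [mul_neg, abs_neg]⟩
  intro hy
  rcases key hx with h | ⟨a, ha, ha'⟩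
  · exact hy.ne h
  rcases key hy with h | ⟨b, hb, hb'⟩
  · exact hx.ne (by linear_combination h + hnn)
  have hab : ((a - b - n : ℤ) : ZMod (2 * n)) = 0 := by
    push_cast
    linear_combination hb - ha
  rw [ZMod.intCast_zmod_eq_zero_iff_dvd] at hab
  obtain ⟨c, hc⟩ := hab
  push_cast at hc
  rw [abs_lt] at ha' hb'
  have h₁ : -1 < 2 * c + 1 := by nlinarith
  have h₂ : 2 * c + 1 < 1 := by nlinarith
  omega

/-- For `n ≥ 5`, `S = {2, 3, ..., ⌈n/2⌉ - 1}`, `i, i+1 ∈ S` and `S' ⊆ S`, the circulant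
graph `C_{2n}({1, i, i+1, n} ∪ S')` is not edge-transitive. -/
theorem circulant_not_edgeTransitive (n : ℕ) (hn : 5 ≤ n) (S : Finset ℤ)
    (hS : S = Finset.Icc 2 (((n : ℤ) + 1) / 2 - 1)) (i : ℤ) (hi : i ∈ S) (hi1 : i + 1 ∈ S)
    (S' : Finset ℤ) (hS' : S' ⊆ S) :
    ¬ EdgeTransitive (circulant (2 * n) ({1, i, i + 1, (n : ℤ)} ∪ S')) := by
  have hnn : ((n : ZMod (2 * n))) ≠ 0 := by
    rw [Ne, ZMod.natCast_eq_zero_iff]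
    exact fun h ↦ by have := Nat.le_of_dvd (by omega) h; omega
  have hne {a : ℤ} (h0 : 0 < a) (h : a < 2 * n) : (a : ZMod (2 * n)) ≠ 0 := by
    rw [Ne, ZMod.intCast_zmod_eq_zero_iff_dvd]
    exact fun hd ↦ by have := Int.le_of_dvd h0 hd; push_cast at this; omega
  subst hS
  rw [Finset.mem_Icc] at hi hi1
  intro hG
  set L : Finset ℤ := {1, i, i + 1, (n : ℤ)} ∪ S' with hLdef
  have hL : ∀ l ∈ L, l = n ∨ |2 * l| < (n : ℤ) := by
    intro l hl
    rw [abs_lt]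
    simp only [hLdef, Finset.mem_union, Finset.mem_insert, Finset.mem_singleton] at hl
    rcases hl with hl | hl
    · omega
    · have := Finset.mem_Icc.1 (hS' hl)
      omega
  have h01 : (circulant (2 * n) L).Adj 0 1 := circulant_adj_iff.2
    ⟨fun h ↦ hne (a := 1) (by omega) (by omega) (by simpa using h.symm), 1, by simp [L], by simp⟩
  have h0n : (circulant (2 * n) L).Adj 0 (n : ZMod (2 * n)) := circulant_adj_iff.2
    ⟨hnn.symm, n, by simp [L], by simp⟩
  have hw0 : (circulant (2 * n) L).Adj ((i + 1 : ℤ) : ZMod (2 * n)) 0 := circulant_adj_iff.2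
    ⟨hne (by omega) (by omega), i + 1, by simp [L], by simp⟩
  have hw1 : (circulant (2 * n) L).Adj ((i + 1 : ℤ) : ZMod (2 * n)) 1 := circulant_adj_iff.2
    ⟨fun h ↦ hne (a := i) (by omega) (by omega) (by simpa using h), i, by simp [L], by simp⟩
  obtain ⟨φ, hφ⟩ := hG s(0, 1) h01 s(0, (n : ZMod (2 * n))) h0n
  rw [← φ.map_adj_iff] at hw0 hw1
  rw [Sym2.map_mk, Sym2.eq_iff] at hφ
  rcases hφ with ⟨h0, h1⟩ | ⟨h0, h1⟩
  · rw [h0] at hw0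
    rw [h1, ← zero_add (n : ZMod (2 * n))] at hw1
    exact not_adj_add_half_of_adj hL hw0 hw1
  · rw [h1] at hw1
    rw [h0, ← zero_add (n : ZMod (2 * n))] at hw0
    exact not_adj_add_half_of_adj hL hw1 hw0
end

section
/- Let n ≥ 2 and let a, b be integers with 1 < a < b < n/2 satisfying ab ≡ ±1 (mod n), a² ≡ ±b (mod n), and b² ≡ ±a (mod n). Then the circulant graph C_n({1, a, b}) is edge-transitive. -/
/-- If the connection set of a circulant graph over a commutative ring is a group under
multiplication that is closed under negation, then the graph is edge-transitive. -/
theorem edgeTransitive_circulantGraph_of_mul_closed {R : Type*} [CommRing R] {S : Set R}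
    (hneg : ∀ x ∈ S, -x ∈ S) (hmul : ∀ x ∈ S, ∀ y ∈ S, x * y ∈ S)
    (hinv : ∀ x ∈ S, ∃ y ∈ S, x * y = 1) :
    EdgeTransitive (SimpleGraph.circulantGraph S) := by
  have hadj (x y : R) : (SimpleGraph.circulantGraph S).Adj x y ↔ x ≠ y ∧ x - y ∈ S := by
    rw [SimpleGraph.circulantGraph, SimpleGraph.fromRel_adj]
    refine and_congr_right fun _ => ⟨?_, Or.inl⟩
    rintro (h | h)
    · exact h
    · simpa using hneg _ h
  intro e₁ he₁ e₂ he₂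
  induction e₁ with | _ x₁ y₁
  induction e₂ with | _ x₂ y₂
  rw [SimpleGraph.mem_edgeSet, hadj] at he₁ he₂
  obtain ⟨p, hp, hp1⟩ := hinv _ he₁.2
  obtain ⟨q, hq, hq1⟩ := hinv _ he₂.2
  have hu : (x₂ - y₂) * p ∈ S := hmul _ he₂.2 _ hp
  have hv : (x₁ - y₁) * q ∈ S := hmul _ he₁.2 _ hq
  obtain ⟨u, hu_def⟩ : ∃ u, u = (x₂ - y₂) * p := ⟨_, rfl⟩
  obtain ⟨v, hv_def⟩ : ∃ v, v = (x₁ - y₁) * q := ⟨_, rfl⟩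
  have huv : u * v = 1 := by
    linear_combination v * hu_def + (x₂ - y₂) * p * hv_def + (x₂ - y₂) * q * hp1 + hq1
  rw [← hu_def] at hu
  rw [← hv_def] at hv
  let f : R ≃ R :=
    { toFun := fun z => u * (z - x₁) + x₂
      invFun := fun z => v * (z - x₂) + x₁
      left_inv := fun z => by linear_combination (z - x₁) * huv
      right_inv := fun z => by linear_combination (z - x₂) * huv }
  refine ⟨⟨f, fun {x y} => ?_⟩, ?_⟩
  · have hsub : f x - f y = u * (x - y) := by
      simp only [f, Equiv.coe_fn_mk]
      ring
    rw [hadj, hadj, f.injective.ne_iff, hsub]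
    refine and_congr_right fun _ => ⟨fun h => ?_, hmul _ hu _⟩
    convert hmul _ hv _ h using 1
    linear_combination -(x - y) * huv
  · change s(f x₁, f y₁) = s(x₂, y₂)
    congr 2
    · simp [f]
    · simp only [f, Equiv.coe_fn_mk]
      linear_combination (y₁ - x₁) * hu_def - (x₂ - y₂) * hp1

/-- The set `{±1, ±a, ±b}`. -/
def signedTriple {R : Type*} [CommRing R] (a b : R) : Set R :=
  {x | ∃ y ∈ ({1, a, b} : Set R), x = y ∨ x = -y}

theorem neg_mem_signedTriple {R : Type*} [CommRing R] {a b x : R}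
    (hx : x ∈ signedTriple a b) : -x ∈ signedTriple a b := by
  obtain ⟨y, hy, h | h⟩ := hx <;> subst x
  · exact ⟨y, hy, Or.inr rfl⟩
  · exact ⟨y, hy, Or.inl (neg_neg y)⟩

theorem mul_mem_signedTriple {R : Type*} [CommRing R] {a b : R}
    (hab : a * b = 1 ∨ a * b = -1) (ha : a ^ 2 = b ∨ a ^ 2 = -b) (hb : b ^ 2 = a ∨ b ^ 2 = -a)
    {x y : R} (hx : x ∈ signedTriple a b) (hy : y ∈ signedTriple a b) :
    x * y ∈ signedTriple a b := by
  have key : ∀ s ∈ ({1, a, b} : Set R), ∀ t ∈ ({1, a, b} : Set R), s * t ∈ signedTriple a b := by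
    have h1 : (1 : R) ∈ ({1, a, b} : Set R) := by simp
    have h2 : a ∈ ({1, a, b} : Set R) := by simp
    have h3 : b ∈ ({1, a, b} : Set R) := by simp
    rintro s (rfl | rfl | rfl) t (rfl | rfl | rfl)
    · exact ⟨1, h1, by simp⟩
    · exact ⟨_, h2, by simp⟩
    · exact ⟨_, h3, by simp⟩
    · exact ⟨_, h2, by simp⟩
    · exact ⟨_, h3, by rwa [← sq]⟩
    · exact ⟨1, h1, hab⟩
    · exact ⟨_, h3, by simp⟩
    · exact ⟨1, h1, by rwa [mul_comm]⟩
    · exact ⟨_, h2, by rwa [← sq]⟩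
  obtain ⟨s, hs, h | h⟩ := hx <;> obtain ⟨t, ht, h' | h'⟩ := hy <;> subst x y
  · exact key s hs t ht
  · simpa using neg_mem_signedTriple (key s hs t ht)
  · simpa using neg_mem_signedTriple (key s hs t ht)
  · simpa using key s hs t ht

theorem exists_mul_eq_one_of_mem_signedTriple {R : Type*} [CommRing R] {a b : R}
    (hab : a * b = 1 ∨ a * b = -1) {x : R} (hx : x ∈ signedTriple a b) :
    ∃ y ∈ signedTriple a b, x * y = 1 := by
  have key : ∀ s ∈ ({1, a, b} : Set R), ∃ t ∈ signedTriple a b, s * t = 1 := by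
    rintro s (rfl | rfl | rfl)
    · exact ⟨1, ⟨1, by simp, Or.inl rfl⟩, one_mul 1⟩
    · rcases hab with h | h
      · exact ⟨b, ⟨b, by simp, Or.inl rfl⟩, h⟩
      · exact ⟨-b, ⟨b, by simp, Or.inr rfl⟩, by simp [h]⟩
    · rcases hab with h | h
      · exact ⟨a, ⟨a, by simp, Or.inl rfl⟩, by rwa [mul_comm]⟩
      · exact ⟨-a, ⟨a, by simp, Or.inr rfl⟩, by rw [mul_neg, mul_comm, h, neg_neg]⟩
  obtain ⟨s, hs, h' | h'⟩ := hx <;> obtain ⟨t, ht, h⟩ := key s hs <;> subst x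
  · exact ⟨t, ht, h⟩
  · exact ⟨-t, neg_mem_signedTriple ht, by simpa using h⟩

theorem circulant_eq_circulantGraph_signedTriple (n : ℕ) (a b : ℤ) :
    circulant n ({1, a, b} : Finset ℤ) =
      SimpleGraph.circulantGraph (signedTriple (a : ZMod n) (b : ZMod n)) := by
  ext x y
  have hswap : y - x = -(x - y) := (neg_sub x y).symm
  simp only [circulant, SimpleGraph.circulantGraph, SimpleGraph.fromRel_adj, signedTriple,
    Set.mem_ofPred_eq, Finset.mem_insert, Finset.mem_singleton, Set.mem_insert_iff,
    Set.mem_singleton_iff, exists_eq_or_imp, exists_eq_left, Int.cast_one, hswap,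
    neg_eq_iff_eq_neg, neg_neg]
  tauto

/-- (Onkey) Let `1 < a < b < n/2` with `ab ≡ ±1`, `a² ≡ ±b` and `b² ≡ ±a (mod n)`.
Then the 6-regular circulant `C_n({1,a,b})` is edge-transitive. -/
theorem circulant_three_chord_edgeTransitive (n : ℕ) (hn : 2 ≤ n) (a b : ℤ)
    (ha : 1 < a) (hab : a < b) (hbn : 2 * b < (n : ℤ))
    (h1 : ((a * b : ℤ) : ZMod n) = 1 ∨ ((a * b : ℤ) : ZMod n) = -1)
    (h2 : ((a ^ 2 : ℤ) : ZMod n) = ((b : ℤ) : ZMod n) ∨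
          ((a ^ 2 : ℤ) : ZMod n) = -((b : ℤ) : ZMod n))
    (h3 : ((b ^ 2 : ℤ) : ZMod n) = ((a : ℤ) : ZMod n) ∨
          ((b ^ 2 : ℤ) : ZMod n) = -((a : ℤ) : ZMod n)) :
    EdgeTransitive (circulant n ({1, a, b} : Finset ℤ)) := by
  push_cast at h1 h2 h3
  rw [circulant_eq_circulantGraph_signedTriple]
  exact edgeTransitive_circulantGraph_of_mul_closed (fun _ => neg_mem_signedTriple)
    (fun _ hx _ hy => mul_mem_signedTriple h1 h2 h3 hx hy)
    (fun _ => exists_mul_eq_one_of_mem_signedTriple h1)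
end

section
/- Let n be a positive integer and let L = {1, a₂, …, a_m} be a finite set of integers containing 1. Suppose that the subset T = {l mod n : l ∈ L} ∪ {−l mod n : l ∈ L} of Z/nZ is a subgroup of the multiplicative group of units of Z/nZ (equivalently, every element of T is a unit and T is closed under multiplication modulo n). Then the circulant graph C_n(L) is edge-transitive. -/
theorem Units.val_inv_mem_submonoid {M : Type*} [Monoid M] [Finite Mˣ] (S : Submonoid M)
    (u : Mˣ) (hu : (u : M) ∈ S) : ((u⁻¹ : Mˣ) : M) ∈ S := by
  have h : u⁻¹ = u ^ (orderOf u - 1) := inv_eq_of_mul_eq_one_left <| by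
    rw [pow_sub_one_mul (orderOf_pos u).ne', pow_orderOf_eq_one]
  rw [h, Units.val_pow_eq_pow_val]
  exact pow_mem hu _

/-- A graph on a commutative ring whose adjacency is membership of the difference in a submonoid
of units is edge-transitive, through the maps `x ↦ u * x + c`. -/
theorem edgeTransitive_of_adj_iff_sub_mem {R : Type*} [CommRing R] [Finite Rˣ]
    (G : SimpleGraph R) (S : Submonoid R) (hS : ∀ x ∈ S, IsUnit x)
    (hG : ∀ x y, G.Adj x y ↔ x ≠ y ∧ x - y ∈ S) : EdgeTransitive G := by
  intro e₁ he₁ e₂ he₂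
  induction e₁ with | _ a b
  induction e₂ with | _ c d
  rw [SimpleGraph.mem_edgeSet, hG] at he₁ he₂
  obtain ⟨v, hv⟩ := hS _ he₁.2
  obtain ⟨w, hw⟩ := hS _ he₂.2
  have hvS : (v : R) ∈ S := hv ▸ he₁.2
  have hwS : (w : R) ∈ S := hw ▸ he₂.2
  have hu : ((w * v⁻¹ : Rˣ) : R) ∈ S := by
    simpa using mul_mem hwS (Units.val_inv_mem_submonoid S v hvS)
  have huv : ((w * v⁻¹ : Rˣ) : R) * (a - b) = c - d := by
    rw [← hv, ← hw, ← Units.val_mul, inv_mul_cancel_right]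
  generalize w * v⁻¹ = u at hu huv
  let f : R ≃ R := (Units.mulLeft u).trans (Equiv.addRight (c - u * a))
  have hf : ∀ x, f x = u * x + (c - u * a) := fun _ => rfl
  have hsub : ∀ x y, f x - f y = u * (x - y) := fun x y => by rw [hf, hf]; ring
  refine ⟨⟨f, fun {x y} => ?_⟩, ?_⟩
  · rw [hG, hG, f.injective.ne_iff, hsub]
    refine and_congr_right fun _ => ⟨fun h => ?_, fun h => mul_mem hu h⟩
    simpa using mul_mem (Units.val_inv_mem_submonoid S u hu) h
  · change s(f a, f b) = s(c, d)
    have ha : f a = c := by rw [hf]; ring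
    have hb : f b = d := by rw [hf]; linear_combination -huv
    rw [ha, hb]

/-- If the set of chord lengths of a circulant graph together with their negatives forms a
group under multiplication mod `n` (equivalently, each element is a unit and the set is
closed under multiplication), then the circulant graph is edge-transitive. -/
theorem circulant_chord_group_edgeTransitive (n : ℕ) (hn : 0 < n) (L : Finset ℤ)
    (h1 : (1 : ℤ) ∈ L) (T : Set (ZMod n))
    (hT : T = {x : ZMod n | ∃ l ∈ L, x = (l : ZMod n) ∨ x = -(l : ZMod n)})
    (hunit : ∀ x ∈ T, IsUnit x) (hmul : ∀ x ∈ T, ∀ y ∈ T, x * y ∈ T) :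
    EdgeTransitive (circulant n L) := by
  have : NeZero n := ⟨hn.ne'⟩
  have h1T : (1 : ZMod n) ∈ T := hT ▸ ⟨1, h1, Or.inl (by simp)⟩
  let S : Submonoid (ZMod n) := ⟨⟨T, fun {x y} hx hy => hmul x hx y hy⟩, h1T⟩
  refine edgeTransitive_of_adj_iff_sub_mem _ S hunit fun x y => ?_
  change _ ↔ x ≠ y ∧ x - y ∈ T
  simp only [circulant, SimpleGraph.circulantGraph_adj, hT, Set.mem_ofPred_eq]
  refine and_congr_right fun _ => ?_
  rw [← neg_sub x y, ← exists_or]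
  simp only [← and_or_left, neg_eq_iff_eq_neg]
end
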